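/- arXiv:1310.7823 — 6 statements merged into one kernel-verified Lean document; each statement's English description precedes it below -/
import Mathlib

section
/- Let Π be a group acting on a tree T by automorphisms, without inversions and transitively on the edges of T, and suppose that adjacent vertices of T always lie in distinct Π-orbits (so the quotient graph Π\T has two vertices). Let e₀,…,e_k be a segment of length k+1 in T; for each i with 0 < i ≤ k let v_i be the common endpoint of e_{i−1} and e_i, and let v₀ be the endpoint of e₀ distinct from v₁. Set Λ = Stab(e₀), Γ₋ = Stab(v₀) and Γ₊ = Stab(v₁). Then there exist elements γ₁,…,γ_k of Π with γ_i ∈ Γ₋ ∖ Λ for each even i and γ_i ∈ Γ₊ ∖ Λ for each odd i, such that for every j ∈ {1,…,k} the element δ_j = γ₁γ₂⋯γ_j satisfies δ_j·e₀ = e_j. -/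
/-- δ_j = γ₁γ₂⋯γ_j (with δ₀ = 1), for a sequence γ indexed from 1. -/
def dseq {Gp : Type*} [Group Gp] (γ : ℕ → Gp) (i : ℕ) : Gp :=
  ((List.range i).map (fun t => γ (t + 1))).prod

theorem dseq_zero {Gp : Type*} [Group Gp] (γ : ℕ → Gp) : dseq γ 0 = 1 := by
  simp [dseq]

theorem dseq_succ {Gp : Type*} [Group Gp] (γ : ℕ → Gp) (i : ℕ) :
    dseq γ (i + 1) = dseq γ i * γ (i + 1) := by
  simp [dseq, List.range_succ]

/-- Successive quotients of a sequence starting at `1` multiply back to the sequence. -/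
theorem dseq_inv_mul {Gp : Type*} [Group Gp] (d : ℕ → Gp) (h0 : d 0 = 1) (j : ℕ) :
    dseq (fun i => (d (i - 1))⁻¹ * d i) j = d j := by
  induction j with
  | zero => rw [dseq_zero, h0]
  | succ j ih => simp [dseq_succ, ih]

/-- Case **S** of Lemma `treecrawler`: a group `Gp` acts on a tree `T` by automorphisms,
without inversions, transitively on edges, and with adjacent vertices in distinct orbits.
Given a segment `e₀,…,e_k` with vertex path `v 0, v 1, …, v (k+1)` (so `v 0` is the endpoint
of `e₀` distinct from `v 1`, and for `0 < i ≤ k` the vertex `v i` is the common endpoint of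
`e (i-1)` and `e i`), there are `γ₁,…,γ_k`, with `γ i ∈ Stab(v 0) ∖ Stab(e 0)` for even `i`
and `γ i ∈ Stab(v 1) ∖ Stab(e 0)` for odd `i`, such that `δ_j = γ₁⋯γ_j` carries `e 0` to `e j`. -/
theorem stmt_0 {V : Type*} {Gp : Type*} [Group Gp] [MulAction Gp V]
    (T : SimpleGraph V) (hT : T.IsTree)
    (hact : ∀ (g : Gp) (u w : V), T.Adj u w → T.Adj (g • u) (g • w))
    (hnoinv : ∀ (g : Gp) (u w : V), T.Adj u w → ¬(g • u = w ∧ g • w = u))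
    (hdistinct : ∀ (u w : V), T.Adj u w → ∀ g : Gp, g • u ≠ w)
    (htrans : ∀ e ∈ T.edgeSet, ∀ e' ∈ T.edgeSet, ∃ g : Gp, Sym2.map (g • ·) e = e')
    (k : ℕ) (v : ℕ → V) (e : ℕ → Sym2 V)
    (hadj : ∀ i ≤ k, T.Adj (v i) (v (i + 1)))
    (he : ∀ i ≤ k, e i = s(v i, v (i + 1)))
    (hne : ∀ i, 1 ≤ i → i ≤ k → e i ≠ e (i - 1)) :
    ∃ γ : ℕ → Gp,
      (∀ i, 1 ≤ i → i ≤ k → Even i →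
          γ i • v 0 = v 0 ∧ Sym2.map (γ i • ·) (e 0) ≠ e 0) ∧
      (∀ i, 1 ≤ i → i ≤ k → Odd i →
          γ i • v 1 = v 1 ∧ Sym2.map (γ i • ·) (e 0) ≠ e 0) ∧
      (∀ j, 1 ≤ j → j ≤ k → Sym2.map ((dseq γ j) • ·) (e 0) = e j) := by
  have key : ∀ i, i ≤ k → ∃ g : Gp, (i = 0 → g = 1) ∧
      (Even i → g • v 0 = v i ∧ g • v 1 = v (i + 1)) ∧
      (Odd i → g • v 1 = v i ∧ g • v 0 = v (i + 1)) := by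
    intro i
    induction i with
    | zero => exact fun _ => ⟨1, by simp⟩
    | succ i ih =>
      intro hi
      obtain ⟨h, -, hev, hod⟩ := ih (by omega)
      obtain ⟨g, hg⟩ := htrans s(v 0, v 1) (hadj 0 (by omega)) s(v (i + 1), v (i + 1 + 1))
        (hadj (i + 1) hi)
      have hd := hdistinct _ _ (hadj i (by omega)) (g * h⁻¹)
      rw [Sym2.map_mk, Sym2.eq_iff] at hg
      refine ⟨g, by simp, fun hpar => ?_, fun hpar => ?_⟩
      · obtain ⟨h1, h0⟩ := hod (by grind)
        rcases hg with hg | hg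
        · exact hg
        · exact absurd (by rw [← h1, mul_smul, inv_smul_smul, hg.2]) hd
      · obtain ⟨h0, h1⟩ := hev (by grind)
        rcases hg with hg | hg
        · exact absurd (by rw [← h0, mul_smul, inv_smul_smul, hg.1]) hd
        · exact hg.symm
  choose! d hd0 hdev hdod using key
  have hde : ∀ i ≤ k, Sym2.map (d i • ·) (e 0) = e i := by
    intro i hi
    rw [he 0 (by omega), he i hi, Sym2.map_mk, Sym2.eq_iff]
    rcases Nat.even_or_odd i with h | h
    · exact Or.inl (hdev i hi h)
    · exact Or.inr (hdod i hi h).symm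
  have hmove : ∀ i, 1 ≤ i → i ≤ k →
      Sym2.map (((d (i - 1))⁻¹ * d i) • ·) (e 0) ≠ e 0 := by
    intro i h1 hi heq
    apply hne i h1 hi
    rw [← hde i hi, ← hde (i - 1) (by omega)]
    conv_rhs => rw [← heq, Sym2.map_map]
    congr 1
    funext x
    simp [mul_smul]
  refine ⟨fun i => (d (i - 1))⁻¹ * d i, fun i h1 hi hpar => ⟨?_, hmove i h1 hi⟩,
    fun i h1 hi hpar => ⟨?_, hmove i h1 hi⟩, fun j _ hj => ?_⟩
  · obtain ⟨i, rfl⟩ := Nat.exists_eq_add_of_le' h1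
    have h := (hdod i (by omega) (by grind)).2
    simp only [Nat.add_sub_cancel, mul_smul]
    rw [(hdev (i + 1) hi hpar).1, inv_smul_eq_iff, h]
  · obtain ⟨i, rfl⟩ := Nat.exists_eq_add_of_le' h1
    have h := (hdev i (by omega) (by grind)).2
    simp only [Nat.add_sub_cancel, mul_smul]
    rw [(hdod (i + 1) hi hpar).1, inv_smul_eq_iff, h]
  · rw [dseq_inv_mul d (hd0 0 (by omega) rfl)]
    exact hde j hj
end

section
/- Let Π be a group acting on a tree T by automorphisms, preserving a Π-invariant orientation O of T (in particular the action is without inversions), transitively on the edges of T and transitively on the vertices of T (so the quotient graph Π\T has a single vertex). Let e₀,…,e_k be a segment of length k+1 in T; for each i with 0 < i ≤ k let v_i be the common endpoint of e_{i−1} and e_i, let v₀ be the endpoint of e₀ distinct from v₁, and let v_{k+1} be the endpoint of e_k distinct from v_k. Assume e₀ is oriented from v₀ to v₁. Let Γ = Stab(v₀), let e' be an edge containing v₀ that is oriented toward v₀, and let τ ∈ Π satisfy τ·e' = e₀. Set ε₀ = 1, and for 1 ≤ i ≤ k set ε_i = 1 if e_i is oriented from v_i to v_{i+1} and ε_i =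 −1 otherwise. Then there exist γ₁,…,γ_k ∈ Γ such that for each j ∈ {1,…,k} the element δ_j = τ(γ₁τ^{ε₁})(γ₂τ^{ε₂})⋯(γ_{j−1}τ^{ε_{j−1}}) (so δ₁ = τ) satisfies δ_j·v₀ = v_j, and e_j = δ_jγ_j·e₀ if ε_j = 1 while e_j = δ_jγ_j·e' if ε_j = −1. Moreover, for each i ≥ 1: if ε_{i−1} = 1 and ε_i = −1 then γ_i ∉ Stab(e'), and if ε_{i−1} = −1 and ε_i = 1 then γ_i ∉ Stab(e₀). -/
/-- δ_j = τ(γ₁τ^{ε₁})(γ₂τ^{ε₂})⋯(γ_{j−1}τ^{ε_{j−1}}) (so δ₁ = τ). -/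
def dseqN {Gp : Type*} [Group Gp] (τ : Gp) (γ : ℕ → Gp) (ε : ℕ → ℤ) (j : ℕ) : Gp :=
  τ * ((List.range (j - 1)).map (fun t => γ (t + 1) * τ ^ ε (t + 1))).prod

theorem dseqN_one {Gp : Type*} [Group Gp] (τ : Gp) (γ : ℕ → Gp) (ε : ℕ → ℤ) :
    dseqN τ γ ε 1 = τ := by
  simp [dseqN]

theorem dseqN_add_two {Gp : Type*} [Group Gp] (τ : Gp) (γ : ℕ → Gp) (ε : ℕ → ℤ) (n : ℕ) :
    dseqN τ γ ε (n + 2) = dseqN τ γ ε (n + 1) * γ (n + 1) * τ ^ ε (n + 1) := by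
  simp [dseqN, List.range_succ, mul_assoc]

/-- A sequence `γ` can be chosen recursively so that each `γ i` satisfies a condition depending
on the partial product `dseqN τ γ ε i`. -/
theorem exists_seq_dseqN {Gp : Type*} [Group Gp] (τ : Gp) (ε : ℕ → ℤ) (c : ℕ → Gp → Gp) :
    ∃ γ : ℕ → Gp, ∀ n, γ (n + 1) = c (n + 1) (dseqN τ γ ε (n + 1)) := by
  let D : ℕ → Gp := fun n =>
    Nat.rec τ (fun n d => d * c (n + 1) d * τ ^ ε (n + 1)) n
  refine ⟨fun i => c i (D (i - 1)), fun n => ?_⟩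
  have hD : ∀ n, dseqN τ (fun i => c i (D (i - 1))) ε (n + 1) = D n := by
    intro n
    induction n with
    | zero => exact dseqN_one _ _ _
    | succ n ih => rw [dseqN_add_two, ih]; rfl
  rw [hD]
  rfl

theorem sym2_map_mul_smul {V Gp : Type*} [Group Gp] [MulAction Gp V] (a b : Gp) (x : Sym2 V) :
    Sym2.map ((a * b) • ·) x = Sym2.map (a • ·) (Sym2.map (b • ·) x) := by
  rw [Sym2.map_map]
  congr 1
  funext y
  exact mul_smul a b y

/-- Case **N** of Lemma `treecrawler`: a group `Gp` acts on a tree `T` by automorphisms,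
preserving an invariant orientation `O`, transitively on edges and on vertices.  Given a
segment `e 0, …, e k` with vertex path `v 0, …, v (k+1)`, with `e 0` oriented from `v 0`
to `v 1`, an edge `e'` at `v 0` oriented toward `v 0`, an element `τ` with `τ • e' = e 0`,
and signs `ε i` recording the orientation of `e i` along the segment (`ε 0 = 1`), there are
`γ₁,…,γ_k ∈ Stab(v 0)` such that `δ_j • v 0 = v j` and `e j = δ_jγ_j • e 0` if `ε j = 1`,
`e j = δ_jγ_j • e'` if `ε j = -1`; moreover if `ε (i-1) = 1, ε i = -1` then `γ i ∉ Stab(e')`,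
and if `ε (i-1) = -1, ε i = 1` then `γ i ∉ Stab(e 0)`. -/
theorem stmt_1 {V : Type*} {Gp : Type*} [Group Gp] [MulAction Gp V]
    (T : SimpleGraph V) (hT : T.IsTree)
    (hact : ∀ (g : Gp) (u w : V), T.Adj u w → T.Adj (g • u) (g • w))
    (O : Sym2 V → V × V)
    (hO : ∀ e ∈ T.edgeSet, s((O e).1, (O e).2) = e)
    (hOinv : ∀ (g : Gp), ∀ e ∈ T.edgeSet,
      O (Sym2.map (g • ·) e) = (g • (O e).1, g • (O e).2))
    (hetrans : ∀ e ∈ T.edgeSet, ∀ e' ∈ T.edgeSet, ∃ g : Gp, Sym2.map (g • ·) e = e')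
    (hvtrans : ∀ u w : V, ∃ g : Gp, g • u = w)
    (k : ℕ) (v : ℕ → V) (e : ℕ → Sym2 V)
    (hadj : ∀ i ≤ k, T.Adj (v i) (v (i + 1)))
    (he : ∀ i ≤ k, e i = s(v i, v (i + 1)))
    (hne : ∀ i, 1 ≤ i → i ≤ k → e i ≠ e (i - 1))
    (hOe0 : O (e 0) = (v 0, v 1))
    (e' : Sym2 V) (he' : e' ∈ T.edgeSet) (hv0e' : v 0 ∈ e') (hOe' : (O e').2 = v 0)
    (τ : Gp) (hτ : Sym2.map (τ • ·) e' = e 0)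
    (ε : ℕ → ℤ) (hε0 : ε 0 = 1)
    (hε : ∀ i, 1 ≤ i → i ≤ k →
      (ε i = 1 ∧ O (e i) = (v i, v (i + 1))) ∨ (ε i = -1 ∧ O (e i) = (v (i + 1), v i))) :
    ∃ γ : ℕ → Gp,
      (∀ i, 1 ≤ i → i ≤ k → γ i • v 0 = v 0) ∧
      (∀ j, 1 ≤ j → j ≤ k →
        (dseqN τ γ ε j) • v 0 = v j ∧
        (ε j = 1 → Sym2.map ((dseqN τ γ ε j * γ j) • ·) (e 0) = e j) ∧
        (ε j = -1 → Sym2.map ((dseqN τ γ ε j * γ j) • ·) e' = e j)) ∧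
      (∀ i, 1 ≤ i → i ≤ k →
        (ε (i - 1) = 1 → ε i = -1 → Sym2.map (γ i • ·) e' ≠ e') ∧
        (ε (i - 1) = -1 → ε i = 1 → Sym2.map (γ i • ·) (e 0) ≠ e 0)) := by
  have hE : ∀ i ≤ k, e i ∈ T.edgeSet := fun i hi => by
    rw [he i hi]; exact hadj i hi
  have hpair : ∀ a ∈ T.edgeSet, ∀ b ∈ T.edgeSet, ∀ g : Gp, Sym2.map (g • ·) a = b →
      g • (O a).1 = (O b).1 ∧ g • (O a).2 = (O b).2 := by
    intro a ha b _ g hg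
    have h := hOinv g a ha
    rw [hg] at h
    simp [h]
  have h0 := hE 0 (Nat.zero_le k)
  obtain ⟨hτ1, hτ2⟩ := hpair e' he' (e 0) h0 τ hτ
  rw [hOe0] at hτ1 hτ2
  rw [hOe'] at hτ2
  dsimp only at hτ1 hτ2
  have hτinv : Sym2.map (τ⁻¹ • ·) (e 0) = e' := by
    rw [← hτ, ← sym2_map_mul_smul]; simp
  have hstep : ∀ (i : ℕ) (d : Gp), ∃ g : Gp, 1 ≤ i → i ≤ k → d • v 0 = v i →
      g • v 0 = v 0 ∧
      (ε i = 1 → Sym2.map ((d * g) • ·) (e 0) = e i) ∧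
      (ε i = -1 → Sym2.map ((d * g) • ·) e' = e i) ∧
      (d * g * τ ^ ε i) • v 0 = v (i + 1) := by
    intro i d
    by_cases h : 1 ≤ i ∧ i ≤ k
    swap
    · exact ⟨1, fun h1 h2 => absurd ⟨h1, h2⟩ h⟩
    obtain ⟨h1, h2⟩ := h
    rcases hε i h1 h2 with ⟨hi, hOi⟩ | ⟨hi, hOi⟩
    · obtain ⟨g, hg⟩ := hetrans _ h0 _ (hE i h2)
      obtain ⟨ha, hb⟩ := hpair _ h0 _ (hE i h2) g hg
      rw [hOe0, hOi] at ha hb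
      refine ⟨d⁻¹ * g, fun _ _ hd => ⟨?_, ?_, ?_, ?_⟩⟩
      · rw [mul_smul, inv_smul_eq_iff, hd]; exact ha
      · intro _; rw [mul_inv_cancel_left]; exact hg
      · intro h; rw [hi] at h; norm_num at h
      · rw [mul_inv_cancel_left, hi, zpow_one, mul_smul, hτ2]; exact hb
    · obtain ⟨g, hg⟩ := hetrans _ he' _ (hE i h2)
      obtain ⟨ha, hb⟩ := hpair _ he' _ (hE i h2) g hg
      rw [hOi] at ha hb
      rw [hOe'] at hb
      refine ⟨d⁻¹ * g, fun _ _ hd => ⟨?_, ?_, ?_, ?_⟩⟩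
      · rw [mul_smul, inv_smul_eq_iff, hd]; exact hb
      · intro h; rw [hi] at h; norm_num at h
      · intro _; rw [mul_inv_cancel_left]; exact hg
      · rw [mul_inv_cancel_left, hi, zpow_neg_one, mul_smul, inv_smul_eq_iff.2 hτ1.symm]
        exact ha
  choose c hc using hstep
  obtain ⟨γ, hγ⟩ := exists_seq_dseqN τ ε c
  have hδ : ∀ n, n + 1 ≤ k → dseqN τ γ ε (n + 1) • v 0 = v (n + 1) := by
    intro n
    induction n with
    | zero => intro _; rw [dseqN_one]; exact hτ2
    | succ n ih =>
      intro hn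
      rw [dseqN_add_two, hγ n]
      exact (hc (n + 1) _ (by omega) (by omega) (ih (by omega))).2.2.2
  have hP : ∀ n, n + 1 ≤ k → γ (n + 1) • v 0 = v 0 ∧
      (ε (n + 1) = 1 →
        Sym2.map ((dseqN τ γ ε (n + 1) * γ (n + 1)) • ·) (e 0) = e (n + 1)) ∧
      (ε (n + 1) = -1 →
        Sym2.map ((dseqN τ γ ε (n + 1) * γ (n + 1)) • ·) e' = e (n + 1)) := by
    intro n hn
    have h := hc (n + 1) _ (by omega) hn (hδ n hn)
    rw [← hγ n] at h
    exact ⟨h.1, h.2.1, h.2.2.1⟩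
  have hprev_pos : ∀ n, n + 1 ≤ k → ε n = 1 →
      Sym2.map (dseqN τ γ ε (n + 1) • ·) e' = e n := by
    intro n hn hεn
    cases n with
    | zero => rw [dseqN_one]; exact hτ
    | succ n =>
      rw [dseqN_add_two, hεn, zpow_one, sym2_map_mul_smul, hτ]
      exact (hP n (by omega)).2.1 hεn
  have hprev_neg : ∀ n, n + 1 ≤ k → ε n = -1 →
      Sym2.map (dseqN τ γ ε (n + 1) • ·) (e 0) = e n := by
    intro n hn hεn
    cases n with
    | zero => rw [hε0] at hεn; norm_num at hεn
    | succ n =>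
      rw [dseqN_add_two, hεn, zpow_neg_one, sym2_map_mul_smul, hτinv]
      exact (hP n (by omega)).2.2 hεn
  refine ⟨γ, ?_, ?_, ?_⟩
  · intro i h1 h2
    obtain ⟨n, rfl⟩ := Nat.exists_eq_add_of_le' h1
    exact (hP n h2).1
  · intro i h1 h2
    obtain ⟨n, rfl⟩ := Nat.exists_eq_add_of_le' h1
    exact ⟨hδ n h2, (hP n h2).2⟩
  · intro i h1 h2
    obtain ⟨n, rfl⟩ := Nat.exists_eq_add_of_le' h1
    have hn := hne (n + 1) h1 h2
    rw [Nat.add_sub_cancel] at hn ⊢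
    refine ⟨fun hp hq hfix => hn ?_, fun hp hq hfix => hn ?_⟩
    · rw [← (hP n h2).2.2 hq, sym2_map_mul_smul, hfix, hprev_pos n h2 hp]
    · rw [← (hP n h2).2.1 hq, sym2_map_mul_smul, hfix, hprev_neg n h2 hp]
end

section
/- Let Π be a group acting on a tree T by automorphisms such that adjacent vertices of T always lie in distinct Π-orbits. If e and e' are edges of T that share a vertex v and lie in the same Π-orbit, then there exists h ∈ Stab(v) with h·e = e'. In other words, for such an action the stabilizer of any vertex v acts transitively on each Π-equivalence class of edges containing v. -/
/-- If a group `Gp` acts on a tree `T` by automorphisms with adjacent vertices always in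
distinct orbits, and `e`, `e'` are edges sharing a vertex `v` and lying in the same
`Gp`-orbit, then some `h ∈ Stab(v)` carries `e` to `e'`. -/
theorem stmt_2 {V : Type*} {Gp : Type*} [Group Gp] [MulAction Gp V]
    (T : SimpleGraph V) (hT : T.IsTree)
    (hact : ∀ (g : Gp) (u w : V), T.Adj u w → T.Adj (g • u) (g • w))
    (hdistinct : ∀ (u w : V), T.Adj u w → ∀ g : Gp, g • u ≠ w)
    (e e' : Sym2 V) (he : e ∈ T.edgeSet) (he' : e' ∈ T.edgeSet)
    (v : V) (hv : v ∈ e) (hv' : v ∈ e')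
    (horbit : ∃ g : Gp, Sym2.map (g • ·) e = e') :
    ∃ h : Gp, h • v = v ∧ Sym2.map (h • ·) e = e' := by
  obtain ⟨g, rfl⟩ := horbit
  obtain ⟨a, rfl⟩ := Sym2.mem_iff_exists.mp hv
  refine ⟨g, ?_, rfl⟩
  rw [Sym2.map_mk, Sym2.mem_iff] at hv'
  rcases hv' with h | h
  · exact h.symm
  · exact absurd h.symm (hdistinct a v (T.adj_symm he) g)
end

section
/- Let Γ be a finitely generated group that is not cyclic and is freely indecomposable, and let Γ act on a tree T by automorphisms, minimally and k-acylindrically. Then the number of Γ-orbits of vertices of T is at most 1 + 2k(rk Γ − 1), where rk Γ is the rank of Γ. -/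
universe u v

theorem coprod_lift_injective_of_coprodI {G : Type u} [Group G] {H : Fin 3 → Type u}
    [∀ i, Group (H i)] (f : ∀ i, H i →* G)
    (hf : Function.Injective (Monoid.CoprodI.lift f)) :
    Function.Injective (Monoid.Coprod.lift (f 0) (f 1)) := by
  let φ : Monoid.Coprod (H 0) (H 1) →* Monoid.CoprodI H :=
    Monoid.Coprod.lift Monoid.CoprodI.of Monoid.CoprodI.of
  let g : ∀ i, H i →* Monoid.Coprod (H 0) (H 1) :=
    Fin.cons Monoid.Coprod.inl (Fin.cons Monoid.Coprod.inr (fun _ => 1))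
  have hg0 : g 0 = Monoid.Coprod.inl := rfl
  have hg1 : g 1 = Monoid.Coprod.inr := rfl
  have hψφ : (Monoid.CoprodI.lift g).comp φ = MonoidHom.id _ := by
    apply Monoid.Coprod.hom_ext <;> ext x <;> simp [φ, hg0, hg1]
  have hφ : Function.Injective φ :=
    Function.LeftInverse.injective (g := Monoid.CoprodI.lift g) (DFunLike.congr_fun hψφ)
  have h : Monoid.Coprod.lift (f 0) (f 1) = (Monoid.CoprodI.lift f).comp φ := by
    apply Monoid.Coprod.hom_ext <;> ext x <;> simp [φ]
  rw [h]
  exact hf.comp hφ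

/-- Ping-pong with a base point: the third, trivial factor carries the base point, so that no
factor has to contain three elements. -/
theorem coprod_lift_injective_of_ping_pong {G : Type u} [Group G] (A B : Subgroup G)
    (hA : A ≠ ⊥) (hB : B ≠ ⊥) (X Y : Set G) (hXY : Disjoint X Y) (hX1 : 1 ∉ X) (hY1 : 1 ∉ Y)
    (hAX : ∀ a ∈ A, a ≠ 1 → a ∈ X) (hBY : ∀ b ∈ B, b ≠ 1 → b ∈ Y)
    (hAY : ∀ a ∈ A, a ≠ 1 → ∀ g ∈ Y, a * g ∈ X)
    (hBX : ∀ b ∈ B, b ≠ 1 → ∀ g ∈ X, b * g ∈ Y) :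
    Function.Injective (Monoid.Coprod.lift A.subtype B.subtype) := by
  let H : Fin 3 → Subgroup G := ![A, B, ⊥]
  let Z : Fin 3 → Set G := ![X, Y, {1}]
  have hinj : Function.Injective (Monoid.CoprodI.lift fun i => (H i).subtype) := by
    apply Monoid.CoprodI.lift_injective_of_ping_pong (fun i => (H i).subtype) _ Z
    · intro i
      obtain ⟨a, ha, ha1⟩ := A.bot_or_exists_ne_one.resolve_left hA
      obtain ⟨b, hb, hb1⟩ := B.bot_or_exists_ne_one.resolve_left hB
      fin_cases i
      · exact ⟨a, hAX _ ha ha1⟩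
      · exact ⟨b, hBY _ hb hb1⟩
      · exact ⟨1, rfl⟩
    · intro i j hij
      fin_cases i <;> fin_cases j <;>
        simp [Z, Function.onFun, hXY, hXY.symm, hX1, hY1] at hij ⊢
    · rintro i j hij ⟨h, hh⟩ h1 _ ⟨g, hg, rfl⟩
      have h1' : h ≠ 1 := by simpa using h1
      fin_cases i <;> fin_cases j <;> simp [Z, H] at hij hg hh ⊢
      · exact hAY _ hh h1' _ hg
      · subst hg; rw [mul_one]; exact hAX _ hh h1'
      · exact hBX _ hh h1' _ hg
      · subst hg; rw [mul_one]; exact hBY _ hh h1'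
      · exact absurd hh h1'
      · exact absurd hh h1'
    · left; simp
  exact coprod_lift_injective_of_coprodI (fun i => (H i).subtype) hinj

/-- Ping-pong on a single set `S`: the nontrivial elements of `A` move `S` off itself and those of
`B` move the complement of `S` into `S`. -/
theorem nonempty_mulEquiv_coprod {V : Type v} {G : Type u} [Group G] [MulAction G V]
    (A B : Subgroup G) (hA : A ≠ ⊥) (hB : B ≠ ⊥) (hAB : A ⊔ B = ⊤) (S : Set V) (x : V)
    (hx : ∀ a ∈ A, a • x ∉ S) (hAS : ∀ a ∈ A, a ≠ 1 → ∀ v ∈ S, a • v ∉ S)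
    (hBS : ∀ b ∈ B, b ≠ 1 → ∀ v ∉ S, b • v ∈ S) :
    Nonempty (G ≃* Monoid.Coprod A B) := by
  have hx1 : x ∉ S := by simpa using hx 1 A.one_mem
  have hinj := coprod_lift_injective_of_ping_pong A B hA hB
    {g | g ≠ 1 ∧ g • x ∉ S} {g | g • x ∈ S}
    (Set.disjoint_left.mpr fun g hg hg' => hg.2 hg') (by simp) (by simpa using hx1)
    (fun a ha ha1 => ⟨ha1, hx a ha⟩) (fun b hb hb1 => hBS b hb hb1 x hx1)
    (fun a ha ha1 g hg => by
      refine ⟨fun h => ?_, ?_⟩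
      · have : g = a⁻¹ := (inv_eq_of_mul_eq_one_right h).symm
        subst this
        exact hx _ (A.inv_mem ha) hg
      · rw [mul_smul]; exact hAS a ha ha1 _ hg)
    (fun b hb hb1 g hg => by
      rw [Set.mem_ofPred_eq, mul_smul]
      exact hBS b hb hb1 _ hg.2)
  have hsurj : Function.Surjective (Monoid.Coprod.lift A.subtype B.subtype) := by
    rw [← MonoidHom.range_eq_top, Monoid.Coprod.range_lift]
    simpa using hAB
  exact ⟨(MulEquiv.ofBijective _ ⟨hinj, hsurj⟩).symm⟩

/-- `Y` is the side of `y` with respect to the edge from `x` to `y`: that edge is the only one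
leaving `Y`. -/
structure IsHalfTree {V : Type v} (T : SimpleGraph V) (x y : V) (Y : Set V) : Prop where
  mem : y ∈ Y
  notMem : x ∉ Y
  eq_of_adj : ∀ p q, T.Adj p q → p ∉ Y → q ∈ Y → p = x ∧ q = y

theorem SimpleGraph.Connected.forall_of_adj {V : Type v} {T : SimpleGraph V} (hT : T.Connected)
    (f : V → Prop) (hf : ∀ u w, T.Adj u w → f u → f w) {u : V} (hu : f u) (w : V) : f w := by
  obtain ⟨p⟩ := hT.preconnected u w
  induction p with
  | nil => exact hu
  | cons h _ ih => exact ih (hf _ _ h hu)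

theorem SimpleGraph.IsTree.exists_isHalfTree {V : Type v} {T : SimpleGraph V} (hT : T.IsTree)
    {x y : V} (h : T.Adj x y) : ∃ Y, IsHalfTree T x y Y := by
  have hb := SimpleGraph.isAcyclic_iff_forall_adj_isBridge.mp hT.isAcyclic h
  rw [SimpleGraph.isBridge_iff] at hb
  refine ⟨{v | (T.deleteEdges {s(x, y)}).Reachable y v}, .refl _, fun hx => hb ?_, ?_⟩
  · exact SimpleGraph.Reachable.symm hx
  · intro p q hpq hp hq
    by_cases he : s(p, q) = s(x, y)
    · rcases Sym2.eq_iff.mp he with h' | h'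
      · exact h'
      · exact absurd (h'.1 ▸ SimpleGraph.Reachable.refl _) hp
    · refine absurd (SimpleGraph.Reachable.trans hq (SimpleGraph.Adj.reachable ?_)) hp
      rw [SimpleGraph.deleteEdges_adj]
      exact ⟨hpq.symm, fun h' => he (by rw [Sym2.eq_swap]; exact h')⟩

theorem SimpleGraph.induce_connected_of_forall_exists_walk {V : Type v} {T : SimpleGraph V}
    {W : Set V} (hW : W.Nonempty)
    (h : ∀ u ∈ W, ∀ w ∈ W, ∃ p : T.Walk u w, ∀ z ∈ p.support, z ∈ W) :
    (T.induce W).Connected := by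
  obtain ⟨a, ha⟩ := hW
  have : Nonempty W := ⟨⟨a, ha⟩⟩
  refine ⟨fun ⟨u, hu⟩ ⟨w, hw⟩ => ?_⟩
  obtain ⟨p, hp⟩ := h u hu w hw
  exact ⟨p.induce W hp⟩

namespace IsHalfTree

variable {V : Type v} {T : SimpleGraph V} {x y : V} {Y : Set V}

theorem compl (h : IsHalfTree T x y Y) : IsHalfTree T y x Yᶜ where
  mem := h.notMem
  notMem := fun h' => h' h.mem
  eq_of_adj p q hpq hp hq := (h.eq_of_adj q p hpq.symm hq (not_not.mp hp)).symm

theorem smul {G : Type u} [Group G] [MulAction G V]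
    (hact : ∀ (g : G) (u w : V), T.Adj u w → T.Adj (g • u) (g • w))
    (h : IsHalfTree T x y Y) (g : G) : IsHalfTree T (g • x) (g • y) {v | g⁻¹ • v ∈ Y} where
  mem := by simpa using h.mem
  notMem := by simpa using h.notMem
  eq_of_adj p q hpq hp hq := by
    have := h.eq_of_adj _ _ (hact g⁻¹ _ _ hpq) hp hq
    rwa [inv_smul_eq_iff, inv_smul_eq_iff] at this

theorem disjoint (hT : T.IsTree) (h : IsHalfTree T x y Y) {x' y' : V} {Y' : Set V}
    (h' : IsHalfTree T x' y' Y') (hne : s(x, y) ≠ s(x', y')) (hx : x ∉ Y') (hx' : x' ∉ Y)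
    {v : V} (hv : v ∈ Y) (hv' : v ∈ Y') : False := by
  refine h.notMem (hT.connected.forall_of_adj (fun v => v ∈ Y ∧ v ∈ Y') ?_ ⟨hv, hv'⟩ x).1
  rintro u w huw ⟨hu, hu'⟩
  by_contra hcon
  by_cases hw : w ∈ Y
  · have hw' : w ∉ Y' := fun hw' => hcon ⟨hw, hw'⟩
    obtain ⟨rfl, rfl⟩ := h'.eq_of_adj _ _ huw.symm hw' hu'
    exact hx' hw
  · obtain ⟨rfl, rfl⟩ := h.eq_of_adj _ _ huw.symm hw hu
    obtain ⟨rfl, rfl⟩ := h'.eq_of_adj _ _ huw.symm hx hu'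
    exact hne rfl

theorem mem_iff_mem (hT : T.IsTree) (h : IsHalfTree T x y Y) {Y' : Set V}
    (h' : IsHalfTree T x y Y') (v : V) : v ∈ Y ↔ v ∈ Y' := by
  refine hT.connected.forall_of_adj (fun v => v ∈ Y ↔ v ∈ Y') ?_
    (u := y) (by simp [h.mem, h'.mem]) v
  intro u w huw hu
  have key : ∀ {Y Y' : Set V}, IsHalfTree T x y Y → IsHalfTree T x y Y' → (u ∈ Y ↔ u ∈ Y') →
      w ∈ Y → w ∈ Y' := by
    intro Y Y' h h' hu hw
    by_cases hu' : u ∈ Y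
    · by_contra hw'
      obtain ⟨rfl, rfl⟩ := h'.eq_of_adj _ _ huw.symm hw' (hu.1 hu')
      exact h.notMem hw
    · obtain ⟨rfl, rfl⟩ := h.eq_of_adj _ _ huw hu' hw
      exact h'.mem
  exact ⟨key h h' hu, key h' h hu.symm⟩

theorem mem_edges (h : IsHalfTree T x y Y) {u w : V} (p : T.Walk u w)
    (huw : ¬ (u ∈ Y ↔ w ∈ Y)) : s(x, y) ∈ p.edges := by
  have key : ∀ {u w : V} (p : T.Walk u w), u ∈ Y → w ∉ Y → s(x, y) ∈ p.edges := by
    intro u w p hu hw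
    obtain ⟨d, hd, h1, h2⟩ := p.exists_boundary_dart Y hu hw
    obtain ⟨e1, e2⟩ := h.eq_of_adj _ _ d.adj.symm h2 h1
    rw [SimpleGraph.Walk.edges]
    refine List.mem_map.mpr ⟨d, hd, ?_⟩
    rw [← e1, ← e2, Sym2.eq_swap]
    rfl
  by_cases hu : u ∈ Y
  · exact key p hu fun hw => huw (by simp [hu, hw])
  · have := key p.reverse (by_contra fun hw => huw (by simp [hu, hw])) hu
    simpa using this

theorem mem_iff_of_isPath (h : IsHalfTree T x y Y) {u w : V} (p : T.Walk u w) (hp : p.IsPath)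
    (huw : u ∈ Y ↔ w ∈ Y) {z : V} (hz : z ∈ p.support) : z ∈ Y ↔ u ∈ Y := by
  classical
  by_contra hzu
  have h1 := h.mem_edges (p.takeUntil z hz) fun h' => hzu h'.symm
  have h2 := h.mem_edges (p.dropUntil z hz) fun h' => hzu (h'.trans huw.symm)
  have h3 := hp.isTrail.edges_nodup
  rw [← p.take_spec hz, SimpleGraph.Walk.edges_append] at h3
  exact (List.disjoint_of_nodup_append h3) h1 h2

end IsHalfTree

section EdgeStabilizer

variable {V : Type v} {Γ : Type u} [Group Γ] [MulAction Γ V]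

/-- No translate of `Y` separates `u` from `w`. -/
def SameSide (Γ : Type u) [Group Γ] [MulAction Γ V] (Y : Set V) (u w : V) : Prop :=
  ∀ g : Γ, g • u ∈ Y ↔ g • w ∈ Y

namespace SameSide

variable {Y : Set V} {u w z : V}

theorem refl (u : V) : SameSide Γ Y u u := fun _ => Iff.rfl

theorem symm (h : SameSide Γ Y u w) : SameSide Γ Y w u := fun g => (h g).symm

theorem trans (h : SameSide Γ Y u w) (h' : SameSide Γ Y w z) : SameSide Γ Y u z :=
  fun g => (h g).trans (h' g)

theorem smul (h : SameSide Γ Y u w) (g : Γ) : SameSide Γ Y (g • u) (g • w) := by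
  intro g'
  simpa [mul_smul] using h (g' * g)

theorem mem_iff (h : SameSide Γ Y u w) : u ∈ Y ↔ w ∈ Y := by simpa using h 1

theorem inv_smul {g : Γ} (h : SameSide Γ Y u (g • w)) : SameSide Γ Y (g⁻¹ • u) w := by
  simpa using h.smul g⁻¹

end SameSide

/-- The subgroup preserving the `SameSide` class of `z`. -/
def sameSideStabilizer (Γ : Type u) [Group Γ] [MulAction Γ V] (Y : Set V) (z : V) :
    Subgroup Γ where
  carrier := {g | SameSide Γ Y (g • z) z}
  one_mem' := by simpa using SameSide.refl z
  mul_mem' {a b} ha hb := by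
    have : SameSide Γ Y (b • z) z := hb
    have := (this.smul a).trans ha
    rwa [smul_smul] at this
  inv_mem' {a} ha := (SameSide.symm ha).inv_smul

theorem mem_sameSideStabilizer {Y : Set V} {z : V} {g : Γ} :
    g ∈ sameSideStabilizer Γ Y z ↔ SameSide Γ Y (g • z) z := Iff.rfl

variable {T : SimpleGraph V} {x y : V} {Y : Set V}

theorem sameSideStabilizer_ne_top (hT : T.IsTree)
    (hact : ∀ (g : Γ) (u w : V), T.Adj u w → T.Adj (g • u) (g • w))
    (hmin : ∀ W : Set V, W.Nonempty → (∀ g : Γ, ∀ x ∈ W, g • x ∈ W) →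
      (T.induce W).Connected → W = Set.univ)
    (hY : IsHalfTree T x y Y) (z : V) : sameSideStabilizer Γ Y z ≠ ⊤ := by
  intro htop
  have hz : ∀ g : Γ, SameSide Γ Y (g • z) z := fun g =>
    mem_sameSideStabilizer.mp (htop ▸ Subgroup.mem_top g)
  have huniv := hmin {v | SameSide Γ Y v z} ⟨z, SameSide.refl z⟩
    (fun g v hv => (SameSide.smul hv g).trans (hz g)) ?_
  · have hx : SameSide Γ Y x z := huniv.ge (Set.mem_univ x)
    have hy : SameSide Γ Y y z := huniv.ge (Set.mem_univ y)
    exact hY.notMem ((hx.trans hy.symm).mem_iff.mpr hY.mem)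
  · refine SimpleGraph.induce_connected_of_forall_exists_walk ⟨z, SameSide.refl z⟩ ?_
    intro u hu w hw
    obtain ⟨p, hp⟩ := (hT.connected.preconnected u w).exists_isPath
    refine ⟨p, fun v hv => SameSide.trans (fun g => ?_) hu⟩
    have := (hY.smul hact g⁻¹).mem_iff_of_isPath p hp
      (by simpa using (SameSide.trans hu (SameSide.symm hw)) g) hv
    simpa using this

theorem notMem_smul_of_ne_one (hT : T.IsTree)
    (hact : ∀ (g : Γ) (u w : V), T.Adj u w → T.Adj (g • u) (g • w))
    (hY : IsHalfTree T x y Y) (hst : ∀ g : Γ, g • x = x → g • y = y → g = 1)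
    {a : Γ} (ha : a ≠ 1) (h1 : a • x ∉ Y) (h2 : a⁻¹ • x ∉ Y) {v : V} (hv : v ∈ Y) :
    a • v ∉ Y := by
  intro hav
  refine hY.disjoint hT (hY.smul hact a) ?_ h2 h1 hav (by simpa using hv)
  intro he
  rcases Sym2.eq_iff.mp he with h | h
  · exact ha (hst a h.1.symm h.2.symm)
  · exact h1 (h.2 ▸ hY.mem)

theorem eq_top_of_sameSide (hT : T.IsTree)
    (hact : ∀ (g : Γ) (u w : V), T.Adj u w → T.Adj (g • u) (g • w))
    (hY : IsHalfTree T x y Y) (H : Subgroup Γ) (hA : sameSideStabilizer Γ Y x ≤ H)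
    (hxy : ∀ g : Γ, SameSide Γ Y (g • x) y → g ∈ H)
    (hB : sameSideStabilizer Γ Y y ≤ H) : H = ⊤ := by
  have key : ∀ v, ∃ h ∈ H, SameSide Γ Y v (h • x) ∨ SameSide Γ Y v (h • y) := by
    refine hT.connected.forall_of_adj _ ?_
      (u := x) ⟨1, H.one_mem, Or.inl (by simpa using SameSide.refl x)⟩
    rintro v v' hvv' ⟨h, hh, hv⟩
    by_cases hs : SameSide Γ Y v v'
    · exact ⟨h, hh, hv.imp hs.symm.trans hs.symm.trans⟩
    unfold SameSide at hs
    push Not at hs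
    obtain ⟨g, hg⟩ := hs
    have hgH : (∃ z, (z = x ∨ z = y) ∧ g⁻¹ • z = v') ∧ g ∈ H := by
      rcases hg with ⟨h1, h2⟩ | ⟨h1, h2⟩
      · obtain ⟨e1, e2⟩ := hY.eq_of_adj _ _ (hact g _ _ hvv'.symm) h2 h1
        refine ⟨⟨x, Or.inl rfl, by rw [← e1, inv_smul_smul]⟩, ?_⟩
        have e2' : v = g⁻¹ • y := by rw [← e2, inv_smul_smul]
        subst e2'
        rcases hv with hv | hv
        · have := hxy (g * h) (by simpa [mul_smul] using hv.symm.smul g)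
          exact (H.mul_mem_cancel_right hh).mp this
        · have := hB ((mem_sameSideStabilizer (g := g * h) (z := y)).mpr
            (by simpa [mul_smul] using hv.symm.smul g))
          exact (H.mul_mem_cancel_right hh).mp this
      · obtain ⟨e1, e2⟩ := hY.eq_of_adj _ _ (hact g _ _ hvv') h1 h2
        refine ⟨⟨y, Or.inr rfl, by rw [← e2, inv_smul_smul]⟩, ?_⟩
        have e1' : v = g⁻¹ • x := by rw [← e1, inv_smul_smul]
        subst e1'
        rcases hv with hv | hv
        · have := hA ((mem_sameSideStabilizer (g := g * h) (z := x)).mpr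
            (by simpa [mul_smul] using hv.symm.smul g))
          exact (H.mul_mem_cancel_right hh).mp this
        · have := hxy (h⁻¹ * g⁻¹) (by simpa [mul_smul] using hv.smul h⁻¹)
          exact inv_mem_iff.mp ((H.mul_mem_cancel_left (H.inv_mem hh)).mp this)
    obtain ⟨⟨z, hz, rfl⟩, hgH⟩ := hgH
    refine ⟨g⁻¹, H.inv_mem hgH, ?_⟩
    rcases hz with rfl | rfl
    · exact Or.inl (SameSide.refl _)
    · exact Or.inr (SameSide.refl _)
  rw [eq_top_iff]
  intro g _
  obtain ⟨h, hh, hg | hg⟩ := key (g • x)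
  · have := hA ((mem_sameSideStabilizer (g := h⁻¹ * g) (z := x)).mpr (by simpa [mul_smul] using hg.smul h⁻¹))
    exact (H.mul_mem_cancel_left (H.inv_mem hh)).mp this
  · have := hxy (h⁻¹ * g) (by simpa [mul_smul] using hg.smul h⁻¹)
    exact (H.mul_mem_cancel_left (H.inv_mem hh)).mp this

/-- If the two ends of an edge with trivial stabilizer are inequivalent, the group splits as an
amalgam over the trivial group. -/
theorem exists_mulEquiv_coprod_of_forall_not_sameSide (hT : T.IsTree)
    (hact : ∀ (g : Γ) (u w : V), T.Adj u w → T.Adj (g • u) (g • w))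
    (hmin : ∀ W : Set V, W.Nonempty → (∀ g : Γ, ∀ x ∈ W, g • x ∈ W) →
      (T.induce W).Connected → W = Set.univ)
    (hY : IsHalfTree T x y Y) (hst : ∀ g : Γ, g • x = x → g • y = y → g = 1)
    (hxy : ∀ g : Γ, ¬ SameSide Γ Y (g • x) y) :
    ∃ A B : Subgroup Γ, A ≠ ⊥ ∧ B ≠ ⊥ ∧ Nonempty (Γ ≃* Monoid.Coprod A B) := by
  have hAB : sameSideStabilizer Γ Y x ⊔ sameSideStabilizer Γ Y y = ⊤ :=
    eq_top_of_sameSide hT hact hY _ le_sup_left (fun g hg => absurd hg (hxy g)) le_sup_right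
  have hA : sameSideStabilizer Γ Y x ≠ ⊥ := fun h =>
    sameSideStabilizer_ne_top hT hact hmin hY y (by simpa [h] using hAB)
  have hB : sameSideStabilizer Γ Y y ≠ ⊥ := fun h =>
    sameSideStabilizer_ne_top hT hact hmin hY x (by simpa [h] using hAB)
  have hx : ∀ a ∈ sameSideStabilizer Γ Y x, a • x ∉ Y := fun a ha h =>
    hY.notMem ((SameSide.mem_iff ha).mp h)
  have hy : ∀ a ∈ sameSideStabilizer Γ Y y, a • y ∉ Yᶜ := fun a ha h =>
    h ((SameSide.mem_iff ha).mpr hY.mem)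
  refine ⟨_, _, hA, hB, nonempty_mulEquiv_coprod _ _ hA hB hAB Y x hx ?_ ?_⟩
  · intro a ha ha1 v hv
    exact notMem_smul_of_ne_one hT hact hY hst ha1 (hx a ha) (hx _ (inv_mem ha)) hv
  · intro b hb hb1 v hv
    exact not_not.mp (notMem_smul_of_ne_one hT hact hY.compl (fun g h1 h2 => hst g h2 h1) hb1
      (hy b hb) (hy _ (inv_mem hb)) hv)

/-- If the two ends of an edge with trivial stabilizer are equivalent, a cyclic free factor
splits off. -/
theorem exists_mulEquiv_coprod_of_sameSide (hnc : ¬ IsCyclic Γ) (hT : T.IsTree)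
    (hact : ∀ (g : Γ) (u w : V), T.Adj u w → T.Adj (g • u) (g • w))
    (hY : IsHalfTree T x y Y) (hst : ∀ g : Γ, g • x = x → g • y = y → g = 1)
    (hxy : ∃ h : Γ, SameSide Γ Y (h • x) y) :
    ∃ A B : Subgroup Γ, A ≠ ⊥ ∧ B ≠ ⊥ ∧ Nonempty (Γ ≃* Monoid.Coprod A B) := by
  have hnxy : ¬ SameSide Γ Y x y := fun h => hY.notMem (h.mem_iff.mpr hY.mem)
  obtain ⟨h, hh, hinv⟩ : ∃ h : Γ, SameSide Γ Y (h • x) y ∧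
      ((h • x = y ∧ h • y = x) ∨ ∀ g : Γ, g • x = y → g • y ≠ x) := by
    by_cases hi : ∃ g : Γ, g • x = y ∧ g • y = x
    · obtain ⟨g, hg⟩ := hi
      exact ⟨g, hg.1 ▸ SameSide.refl _, Or.inl hg⟩
    · obtain ⟨h, hh⟩ := hxy
      exact ⟨h, hh, Or.inr fun g h1 h2 => hi ⟨g, h1, h2⟩⟩
  set A := sameSideStabilizer Γ Y x with hAdef
  have hAm : ∀ {a}, a ∈ A ↔ SameSide Γ Y (a • x) x := mem_sameSideStabilizer
  have hAB : A ⊔ Subgroup.zpowers h = ⊤ := by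
    have hhm : h ∈ A ⊔ Subgroup.zpowers h :=
      Subgroup.mem_sup_right (Subgroup.mem_zpowers h)
    refine eq_top_of_sameSide hT hact hY _ le_sup_left (fun g hg => ?_) (fun g hg => ?_)
    · have : h⁻¹ * g ∈ A := by
        rw [hAm, mul_smul]
        exact (hg.trans hh.symm).inv_smul
      exact (Subgroup.mul_mem_cancel_left _ (inv_mem hhm)).mp (Subgroup.mem_sup_left this)
    · have : h⁻¹ * g * h ∈ A := by
        rw [hAm, mul_smul, mul_smul]
        exact ((hh.smul g).trans ((mem_sameSideStabilizer.mp hg).trans hh.symm)).inv_smul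
      exact (Subgroup.mul_mem_cancel_left _ (inv_mem hhm)).mp
        ((Subgroup.mul_mem_cancel_right _ hhm).mp (Subgroup.mem_sup_left this))
  have hA : A ≠ ⊥ := by
    intro h0
    rw [h0, bot_sup_eq] at hAB
    exact hnc ⟨h, fun g => hAB.ge (Subgroup.mem_top g)⟩
  have hB : Subgroup.zpowers h ≠ ⊥ := by
    rw [Ne, Subgroup.zpowers_eq_bot]
    rintro rfl
    exact hnxy (by simpa using hh)
  have hx : ∀ a ∈ A, a • x ∉ Y := fun a ha h' =>
    hY.notMem ((SameSide.mem_iff (hAm.mp ha)).mp h')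
  have hhx : ∀ a ∈ A, h • a • x ∈ Y := fun a ha =>
    (((hAm.mp ha).smul h).trans hh).mem_iff.mpr hY.mem
  have hDA : ∀ a ∈ A, a ≠ 1 → ∀ v ∈ Y, a • v ∉ Y := fun a ha ha1 v hv =>
    notMem_smul_of_ne_one hT hact hY hst ha1 (hx a ha) (hx _ (inv_mem ha)) hv
  refine ⟨A, Subgroup.zpowers h, hA, hB, ?_⟩
  rcases hinv with ⟨h1, h2⟩ | hinv
  · have hsq : h * h = 1 := hst _ (by rw [mul_smul, h1, h2]) (by rw [mul_smul, h2, h1])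
    have hinv' : h⁻¹ = h := inv_eq_of_mul_eq_one_left hsq
    refine nonempty_mulEquiv_coprod _ _ hA hB hAB Y x hx hDA ?_
    rintro b ⟨n, rfl⟩ hb1 v hv
    have hhn : h ^ n = h := by
      rcases Int.even_or_odd' n with ⟨m, rfl | rfl⟩
      · exact absurd (by simp [zpow_mul, pow_two, hsq]) hb1
      · simp [zpow_add, zpow_mul, pow_two, hsq]
    have hY' := hY.compl.smul hact h
    rw [h1, h2] at hY'
    have := (hY.mem_iff_mem hT hY' (h • v)).mpr (by simpa using hv)
    simpa [hhn] using this
  · have hhy : ∀ a ∈ A, a • h⁻¹ • y ∉ Y := fun a ha h' => by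
      have : SameSide Γ Y (h⁻¹ • y) x := hh.symm.inv_smul
      exact hY.notMem (((this.smul a).trans (hAm.mp ha)).mem_iff.mp h')
    have hhx1 : h • x ∈ Y := by simpa using hhx 1 (one_mem _)
    have hhy1 : h⁻¹ • y ∉ Y := by simpa using hhy 1 (one_mem _)
    have hYY : ∀ v ∈ Y, h • v ∈ Y := by
      intro v hv
      by_contra hcon
      refine hY.compl.disjoint hT (hY.smul hact h) ?_ hhy1 (fun h' => h' hhx1) hcon
        (by simpa using hv)
      intro he
      rcases Sym2.eq_iff.mp he with h' | h'
      · exact hinv h h'.1.symm h'.2.symm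
      · exact hY.notMem (by rw [h'.2]; exact hhx1)
    have hmix : ∀ a ∈ A, ∀ v ∈ Y, h • a • v ∈ Y := by
      intro a ha v hv
      by_contra hcon
      refine (hY.smul hact a).disjoint hT (hY.compl.smul hact h⁻¹) (v := a • v) ?_
        (by simpa using hhx a ha) (hhy _ (inv_mem ha)) (by simpa using hv) (by simpa using hcon)
      intro he
      rcases Sym2.eq_iff.mp he with h' | h'
      · refine hinv (h * a) ?_ ?_
        · rw [mul_smul, h'.1, smul_inv_smul]
        · rw [mul_smul, h'.2, smul_inv_smul]
      · have : h * a = 1 := hst _ (by rw [mul_smul, h'.1, smul_inv_smul])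
          (by rw [mul_smul, h'.2, smul_inv_smul])
        have hhA : h ∈ A := by
          rw [eq_inv_of_mul_eq_one_left this]
          exact inv_mem ha
        exact hnxy ((hAm.mp hhA).symm.trans hh)
    refine nonempty_mulEquiv_coprod _ _ hA hB hAB {v | v ∈ Y ∨ h • v ∉ Y} x ?_ ?_ ?_
    · rintro a ha (h' | h')
      · exact hx a ha h'
      · exact h' (hhx a ha)
    · rintro a ha ha1 v (hv | hv)
      · rintro (h' | h')
        · exact hDA a ha ha1 v hv h'
        · exact h' (hmix a ha v hv)
      · rintro (h' | h')
        · exact hv (by simpa using hmix _ (inv_mem ha) _ h')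
        · have hcc : ∀ a ∈ A, (h * a * h⁻¹) • y ∉ Yᶜ := fun a ha h' => h' <| by
            rw [mul_smul, mul_smul]
            have : SameSide Γ Y (h⁻¹ • y) x := hh.symm.inv_smul
            exact ((((this.smul a).trans (hAm.mp ha)).smul h).trans hh).mem_iff.mpr hY.mem
          refine notMem_smul_of_ne_one hT hact hY.compl (fun g h1 h2 => hst g h2 h1)
            (a := h * a * h⁻¹) (by simpa using ha1) (hcc a ha) ?_ (v := h • v) hv ?_
          · have := hcc _ (inv_mem ha)
            rwa [show (h * a * h⁻¹)⁻¹ = h * a⁻¹ * h⁻¹ by group]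
          · simpa [mul_smul] using h'
    · rintro b ⟨n, rfl⟩ hb1 v hv
      have hv1 : v ∉ Y := fun h' => hv (Or.inl h')
      have hv2 : h • v ∈ Y := by_contra fun h' => hv (Or.inr h')
      have hpos : ∀ m : ℕ, h ^ (m + 1) • v ∈ Y := by
        intro m
        induction m with
        | zero => simpa using hv2
        | succ m ih => rw [pow_succ', mul_smul]; exact hYY _ ih
      have hneg : ∀ m : ℕ, (h⁻¹) ^ m • v ∉ Y := by
        intro m
        induction m with
        | zero => simpa using hv1
        | succ m ih =>
          rw [pow_succ', mul_smul]
          exact fun h' => ih (by simpa using hYY _ h')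
      rcases lt_trichotomy n 0 with hn | rfl | hn
      · right
        obtain ⟨m, rfl⟩ : ∃ m : ℕ, n = -((m : ℤ) + 1) := ⟨(-n - 1).toNat, by omega⟩
        have := hneg m
        rwa [show h⁻¹ ^ m = h * h ^ (-((m : ℤ) + 1)) by
          rw [zpow_neg, zpow_add, zpow_natCast, zpow_one]; simp, mul_smul] at this
      · simp at hb1
      · left
        obtain ⟨m, rfl⟩ : ∃ m : ℕ, n = (m : ℤ) + 1 := ⟨(n - 1).toNat, by omega⟩
        simpa [zpow_add, pow_succ] using hpos m

/-- In a minimal action of a noncyclic freely indecomposable group on a tree, edge stabilizers are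
nontrivial. -/
theorem exists_ne_one_smul_eq_of_adj (hnc : ¬ IsCyclic Γ)
    (hfi : ∀ (A B : Type u) [Group A] [Group B], Nontrivial A → Nontrivial B →
      IsEmpty (Γ ≃* Monoid.Coprod A B))
    (hT : T.IsTree) (hact : ∀ (g : Γ) (u w : V), T.Adj u w → T.Adj (g • u) (g • w))
    (hmin : ∀ W : Set V, W.Nonempty → (∀ g : Γ, ∀ x ∈ W, g • x ∈ W) →
      (T.induce W).Connected → W = Set.univ)
    (hxy : T.Adj x y) : ∃ g : Γ, g ≠ 1 ∧ g • x = x ∧ g • y = y := by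
  by_contra! hcon
  have hst : ∀ g : Γ, g • x = x → g • y = y → g = 1 := fun g h1 h2 =>
    by_contra fun hg => hcon g hg h1 h2
  obtain ⟨Y, hY⟩ := hT.exists_isHalfTree hxy
  obtain ⟨A, B, hA, hB, ⟨e⟩⟩ :
      ∃ A B : Subgroup Γ, A ≠ ⊥ ∧ B ≠ ⊥ ∧ Nonempty (Γ ≃* Monoid.Coprod A B) := by
    by_cases h : ∃ h : Γ, SameSide Γ Y (h • x) y
    · exact exists_mulEquiv_coprod_of_sameSide hnc hT hact hY hst h
    · exact exists_mulEquiv_coprod_of_forall_not_sameSide hT hact hmin hY hst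
        fun g hg => h ⟨g, hg⟩
  exact (hfi A B ((Subgroup.nontrivial_iff_ne_bot A).mpr hA)
    ((Subgroup.nontrivial_iff_ne_bot B).mpr hB)).false e

end EdgeStabilizer

section Hull

variable {V : Type v} {Γ : Type u} [Group Γ] [MulAction Γ V] {T : SimpleGraph V}

/-- Connectedness of the subgraph induced on a possibly empty set. -/
def SetConn (T : SimpleGraph V) (W : Set V) : Prop :=
  ∀ f : V → Prop, (∀ u ∈ W, ∀ w ∈ W, T.Adj u w → f u → f w) → ∀ u ∈ W, ∀ w ∈ W, f u → f w

/-- Two sets of vertices at distance at most one. -/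
def SetLinked (T : SimpleGraph V) (A B : Set V) : Prop :=
  ∃ a ∈ A, ∃ b ∈ B, a = b ∨ T.Adj a b

namespace SetConn

theorem singleton (a : V) : SetConn T {a} := by
  rintro f - u rfl w rfl h
  exact h

theorem exists_walk {W : Set V} (hW : SetConn T W) {u w : V} (hu : u ∈ W) (hw : w ∈ W) :
    ∃ p : T.Walk u w, ∀ z ∈ p.support, z ∈ W := by
  refine hW (fun w => ∃ p : T.Walk u w, ∀ z ∈ p.support, z ∈ W) ?_ u hu w hw
    ⟨.nil, by simpa using hu⟩
  rintro a - b hb hab ⟨p, hp⟩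
  refine ⟨p.concat hab, fun z hz => ?_⟩
  rw [SimpleGraph.Walk.support_concat, List.mem_append] at hz
  rcases hz with hz | hz
  · exact hp z hz
  · simp only [List.mem_singleton] at hz
    exact hz ▸ hb

theorem of_walk {u w : V} (p : T.Walk u w) : SetConn T {z | z ∈ p.support} := by
  have key : ∀ (f : V → Prop) {u w : V} (p : T.Walk u w),
      (∀ a ∈ p.support, ∀ b ∈ p.support, T.Adj a b → f a → f b) →
      ∀ z ∈ p.support, f u ↔ f z := by
    intro f u w p
    induction p with
    | nil => intro _ z hz; simp at hz; rw [hz]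
    | @cons a b c h p ih =>
      intro hf z hz
      rw [SimpleGraph.Walk.support_cons, List.mem_cons] at hz
      rcases hz with rfl | hz
      · rfl
      · rw [← ih (fun a ha b hb => hf a (by simp [ha]) b (by simp [hb])) z hz]
        exact ⟨hf _ (by simp) _ (by simp) h, hf _ (by simp) _ (by simp) h.symm⟩
  intro f hf a ha b hb
  exact fun h => (key f p hf b hb).mp ((key f p hf a ha).mpr h)

theorem union {A B : Set V} (hA : SetConn T A) (hB : SetConn T B) (h : SetLinked T A B) :
    SetConn T (A ∪ B) := by
  obtain ⟨a, ha, b, hb, hab⟩ := h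
  intro f hf
  have hfA := hA f fun u hu w hw => hf u (Or.inl hu) w (Or.inl hw)
  have hfB := hB f fun u hu w hw => hf u (Or.inr hu) w (Or.inr hw)
  have hfab : f a ↔ f b := by
    rcases hab with rfl | hab
    · rfl
    · exact ⟨hf _ (Or.inl ha) _ (Or.inr hb) hab, hf _ (Or.inr hb) _ (Or.inl ha) hab.symm⟩
  rintro u (hu | hu) w (hw | hw) h
  · exact hfA u hu w hw h
  · exact hfB b hb w hw (hfab.mp (hfA u hu a ha h))
  · exact hfA a ha w hw (hfab.mpr (hfB u hu b hb h))
  · exact hfB u hu w hw h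

theorem preimage_smul (hact : ∀ (g : Γ) (u w : V), T.Adj u w → T.Adj (g • u) (g • w))
    {W : Set V} (hW : SetConn T W) (g : Γ) : SetConn T {v | g • v ∈ W} := by
  intro f hf u hu w hw h
  have := hW (fun z => f (g⁻¹ • z)) ?_ _ hu _ hw (by simpa using h)
  · simpa using this
  · intro a ha b hb hab
    exact hf _ (by simpa using ha) _ (by simpa using hb) (hact _ _ _ hab)

theorem iUnion_closure (hact : ∀ (g : Γ) (u w : V), T.Adj u w → T.Adj (g • u) (g • w))
    {C : Set V} (hC : SetConn T C) (S : Set Γ)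
    (hS : ∀ s ∈ S, SetLinked T C {v | s⁻¹ • v ∈ C}) :
    SetConn T {v | ∃ g ∈ Subgroup.closure S, ∃ c ∈ C, v = g • c} := by
  intro f hf
  have hf' : ∀ g ∈ Subgroup.closure S, ∀ g' ∈ Subgroup.closure S, ∀ a ∈ C, ∀ b ∈ C,
      T.Adj (g • a) (g' • b) → f (g • a) → f (g' • b) :=
    fun g hg g' hg' a ha b hb hab => hf _ ⟨g, hg, a, ha, rfl⟩ _ ⟨g', hg', b, hb, rfl⟩ hab
  have hconn : ∀ g ∈ Subgroup.closure S, ∀ a ∈ C, ∀ b ∈ C, f (g • a) → f (g • b) :=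
    fun g hg a ha b hb => hC (fun z => f (g • z))
      (fun u hu w hw huw => hf' g hg g hg u hu w hw (hact g _ _ huw)) a ha b hb
  have hlink : ∀ g ∈ Subgroup.closure S, ∀ s ∈ S, ∀ a ∈ C, ∀ b ∈ C,
      (f (g • a) ↔ f ((g * s) • b)) := by
    intro g hg s hs a ha b hb
    have hgs : g * s ∈ Subgroup.closure S := mul_mem hg (Subgroup.subset_closure hs)
    obtain ⟨c, hc, d, hd, hcd⟩ := hS s hs
    have hd' : s⁻¹ • d ∈ C := hd
    have hcd' : f (g • c) ↔ f ((g * s) • s⁻¹ • d) := by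
      rcases hcd with rfl | hcd
      · rw [mul_smul, smul_inv_smul]
      · have h1 : T.Adj (g • c) ((g * s) • s⁻¹ • d) := by
          rw [mul_smul, smul_inv_smul]
          exact hact g _ _ hcd
        exact ⟨hf' g hg _ hgs c hc _ hd' h1, hf' _ hgs g hg _ hd' c hc h1.symm⟩
    exact ⟨fun h => hconn _ hgs _ hd' b hb (hcd'.mp (hconn g hg a ha c hc h)),
      fun h => hconn g hg c hc a ha (hcd'.mpr (hconn _ hgs b hb _ hd' h))⟩
  have key : ∀ g ∈ Subgroup.closure S, ∀ a ∈ C, ∀ b ∈ C, (f (g • a) ↔ f b) := by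
    intro g hg
    induction hg using Subgroup.closure_induction_right with
    | one =>
      intro a ha b hb
      have h1 := hconn 1 (one_mem _) a ha b hb
      have h2 := hconn 1 (one_mem _) b hb a ha
      rw [one_smul, one_smul] at h1 h2
      rw [one_smul]
      exact ⟨h1, h2⟩
    | mul_right g hg s hs ih =>
      intro a ha b hb
      rw [← hlink g hg s hs a ha a ha]
      exact ih a ha b hb
    | mul_inv_cancel g hg s hs ih =>
      intro a ha b hb
      have h1 := hlink (g * s⁻¹) (mul_mem hg (inv_mem (Subgroup.subset_closure hs))) s hs a ha a ha
      rw [inv_mul_cancel_right] at h1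
      rw [h1]
      exact ih a ha b hb
  rintro _ ⟨g, hg, a, ha, rfl⟩ _ ⟨g', hg', b, hb, rfl⟩ h
  exact (key g' hg' b hb b hb).mpr ((key g hg a ha b hb).mp h)

theorem induce_connected {W : Set V} (hW : SetConn T W) (hne : W.Nonempty) :
    (T.induce W).Connected :=
  SimpleGraph.induce_connected_of_forall_exists_walk hne fun _ hu _ hw => hW.exists_walk hu hw

end SetConn

theorem SimpleGraph.Walk.exists_setConn_insert_insert {p q : V} (w : T.Walk p q) (n : ℕ)
    (hn : w.length ≤ n + 1) : ∃ D : Finset V, D.card ≤ n ∧ SetConn T ({p, q} ∪ (D : Set V)) := by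
  classical
  induction w generalizing n with
  | nil => exact ⟨∅, by simp, by simpa using SetConn.singleton _⟩
  | @cons a b c h w ih =>
    rw [SimpleGraph.Walk.length_cons] at hn
    cases n with
    | zero =>
      have := SimpleGraph.Walk.eq_of_length_eq_zero (p := w) (by omega)
      subst this
      refine ⟨∅, by simp, ?_⟩
      have := (SetConn.singleton a).union (SetConn.singleton b) ⟨a, rfl, b, rfl, Or.inr h⟩
      convert this using 1
      ext z; simp [or_comm]
    | succ n =>
      obtain ⟨D, hD, hconn⟩ := ih n (by omega)
      refine ⟨insert b D, (Finset.card_insert_le _ _).trans (by omega), ?_⟩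
      have := (SetConn.singleton a).union hconn ⟨a, rfl, b, by simp, Or.inr h⟩
      convert this using 1
      ext z; simp; tauto

/-- The `U`-orbit of a finite set of vertices. -/
def core (U : Subgroup Γ) (F : Finset V) : Set V :=
  {v | ∃ g ∈ U, ∃ c ∈ (F : Set V), v = g • c}

/-- The `U`-orbit of `F` together with the fixed points of the nontrivial elements of `U`. -/
def hull (U : Subgroup Γ) (F : Finset V) : Set V :=
  core U F ∪ {v | ∃ g ∈ U, g ≠ 1 ∧ g • v = v}

theorem core_subset_hull (U : Subgroup Γ) (F : Finset V) : core U F ⊆ hull U F :=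
  Set.subset_union_left

theorem subset_core (U : Subgroup Γ) (F : Finset V) : (F : Set V) ⊆ core U F :=
  fun v hv => ⟨1, U.one_mem, v, hv, (one_smul Γ v).symm⟩

theorem smul_mem_core {U : Subgroup Γ} {F : Finset V} {g : Γ} (hg : g ∈ U) {v : V}
    (hv : v ∈ core U F) : g • v ∈ core U F := by
  obtain ⟨h, hh, c, hc, rfl⟩ := hv
  exact ⟨g * h, mul_mem hg hh, c, hc, by rw [mul_smul]⟩

theorem smul_mem_hull {U : Subgroup Γ} {F : Finset V} {g : Γ} (hg : g ∈ U) {v : V}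
    (hv : v ∈ hull U F) : g • v ∈ hull U F := by
  rcases hv with hv | ⟨h, hh, h1, hv⟩
  · exact Or.inl (smul_mem_core hg hv)
  · exact Or.inr ⟨g * h * g⁻¹, mul_mem (mul_mem hg hh) (inv_mem hg), by simpa using h1,
      by simp [mul_smul, hv]⟩

theorem hull_bot (F : Finset V) : hull (⊥ : Subgroup Γ) F = F := by
  ext v
  simp [hull, core]

theorem hull_eq_core_of_eq_bot {U : Subgroup Γ} (hU : U = ⊥) (F : Finset V) :
    hull U F = core U F := by
  subst hU
  ext v
  simp [hull, core]

/-- `g` fixes the geodesic from a fixed vertex to a connected `g`-invariant set. -/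
theorem SimpleGraph.IsTree.exists_walk_fixed (hT : T.IsTree)
    (hact : ∀ (g : Γ) (u w : V), T.Adj u w → T.Adj (g • u) (g • w))
    {C : Set V} (hC : SetConn T C) (hne : C.Nonempty) {g : Γ} (hg : ∀ v ∈ C, g • v ∈ C)
    {q : V} (hq : g • q = q) :
    ∃ p ∈ C, ∃ w : T.Walk p q, w.IsPath ∧ ∀ z ∈ w.support, g • z = z := by
  classical
  have hex : ∃ n : ℕ, ∃ p ∈ C, ∃ w : T.Walk p q, w.length = n := by
    obtain ⟨p, hp⟩ := hne
    obtain ⟨w⟩ := hT.connected.preconnected p q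
    exact ⟨_, p, hp, w, rfl⟩
  obtain ⟨p, hp, w, hw⟩ := Nat.find_spec hex
  have hmin : ∀ p' ∈ C, ∀ w' : T.Walk p' q, w.length ≤ w'.length := fun p' hp' w' =>
    hw ▸ Nat.find_min' hex ⟨p', hp', w', rfl⟩
  have hwp : w.IsPath := SimpleGraph.Walk.isPath_of_length_eq_dist _ <| by
    obtain ⟨w', hw'⟩ := (hT.connected.preconnected p q).exists_walk_length_eq_dist
    exact le_antisymm (hw' ▸ hmin p hp w') (SimpleGraph.dist_le w)
  have hCw : ∀ z ∈ w.support, z ∈ C → z = p := by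
    intro z hz hzC
    have h1 := hmin z hzC (w.dropUntil z hz)
    have h2 := congrArg SimpleGraph.Walk.length (w.take_spec hz)
    rw [SimpleGraph.Walk.length_append] at h2
    exact (SimpleGraph.Walk.eq_of_length_eq_zero (p := w.takeUntil z hz) (by omega)).symm
  let φ : T →g T := ⟨fun v => g • v, fun h => hact g _ _ h⟩
  let w' : T.Walk (g • p) q := (w.map φ).copy rfl hq
  have hw'p : w'.IsPath := by
    rw [SimpleGraph.Walk.isPath_copy]
    exact hwp.map (MulAction.injective g)
  have hw'len : w'.length = w.length := by simp [w']
  obtain ⟨P0, hP0⟩ := hC.exists_walk hp (hg p hp)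
  let P := P0.bypass
  have hP : ∀ z ∈ P.support, z ∈ C := fun z hz => hP0 z (P0.support_bypass_subset_support hz)
  have hCw' : ∀ z ∈ w'.support, z ∈ C → z = g • p := by
    intro z hz hzC
    have h1 := hmin z hzC (w'.dropUntil z hz)
    have h2 := congrArg SimpleGraph.Walk.length (w'.take_spec hz)
    rw [SimpleGraph.Walk.length_append] at h2
    exact (SimpleGraph.Walk.eq_of_length_eq_zero (p := w'.takeUntil z hz) (by omega)).symm
  have happ : (P.append w').IsPath := by
    rw [SimpleGraph.Walk.isPath_def, SimpleGraph.Walk.support_append]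
    have hnd := hw'p.support_nodup
    rw [← SimpleGraph.Walk.cons_tail_support, List.nodup_cons] at hnd
    refine List.Nodup.append P0.bypass_isPath.support_nodup hnd.2 ?_
    intro z hz hz'
    have := hCw' z (List.mem_of_mem_tail hz') (hP z hz)
    exact hnd.1 (this ▸ hz')
  have heq := congrArg Subtype.val
    ((hT.isAcyclic.subsingleton_path _ _).elim ⟨w, hwp⟩ ⟨P.append w', happ⟩)
  simp only at heq
  have hlen := congrArg SimpleGraph.Walk.length heq
  rw [SimpleGraph.Walk.length_append, hw'len] at hlen
  have hgp : p = g • p := SimpleGraph.Walk.eq_of_length_eq_zero (p := P) (by omega)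
  refine ⟨p, hp, w, hwp, ?_⟩
  have heq' := congrArg Subtype.val
    ((hT.isAcyclic.subsingleton_path _ _).elim ⟨w, hwp⟩ ⟨w'.copy hgp.symm rfl, by simpa using hw'p⟩)
  simp only at heq'
  intro z hz
  obtain ⟨n, rfl, hn⟩ := SimpleGraph.Walk.mem_support_iff_exists_getVert.mp hz
  have : (w'.copy hgp.symm rfl).getVert n = g • w.getVert n := by
    simp [w', SimpleGraph.Walk.getVert_map, φ]
  rw [← this, ← heq']

/-- The action is `k`-acylindrical. -/
def IsAcylindrical (Γ : Type u) [Group Γ] [MulAction Γ V] (T : SimpleGraph V) (k : ℕ) : Prop :=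
  ∀ g : Γ, g ≠ 1 → ∀ m : ℕ, k < m → ∀ p : ℕ → V,
    (∀ i < m, T.Adj (p i) (p (i + 1))) →
    (∀ i, 1 ≤ i → i < m → s(p i, p (i + 1)) ≠ s(p (i - 1), p i)) →
    ¬ (∀ i ≤ m, g • p i = p i)

theorem IsAcylindrical.length_le {k : ℕ} (hacyl : IsAcylindrical Γ T k) {g : Γ} (hg : g ≠ 1)
    {p q : V} (w : T.Walk p q) (hw : w.IsPath) (hfix : ∀ z ∈ w.support, g • z = z) :
    w.length ≤ k := by
  by_contra! hlt
  refine hacyl g hg _ hlt w.getVert (fun i hi => w.adj_getVert_succ hi) ?_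
    (fun i _ => hfix _ (w.getVert_mem_support i))
  intro i h1 hi he
  have hinj := hw.getVert_injOn
  rcases Sym2.eq_iff.mp he with h | h
  · have := hinj (by simp; omega) (by simp; omega) h.1
    omega
  · have := hinj (by simp; omega) (by simp; omega) h.2
    omega

theorem exists_walk_of_mem_hull (hT : T.IsTree)
    (hact : ∀ (g : Γ) (u w : V), T.Adj u w → T.Adj (g • u) (g • w))
    {k : ℕ} (hacyl : IsAcylindrical Γ T k) {U : Subgroup Γ} {F : Finset V}
    (hC : SetConn T (core U F)) (hF : F.Nonempty) {q : V} (hq : q ∈ hull U F) :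
    ∃ p ∈ core U F, ∃ w : T.Walk p q, w.length ≤ k ∧ ∀ z ∈ w.support, z ∈ hull U F := by
  rcases hq with hq | ⟨g, hg, h1, hq⟩
  · exact ⟨q, hq, .nil, by simp, by simpa using core_subset_hull U F hq⟩
  · obtain ⟨p, hp, w, hw, hfix⟩ := hT.exists_walk_fixed hact hC
      (hF.to_set.mono (subset_core U F)) (fun v hv => smul_mem_core hg hv) hq
    exact ⟨p, hp, w, hacyl.length_le h1 w hw hfix, fun z hz => Or.inr ⟨g, hg, h1, hfix z hz⟩⟩

theorem setConn_hull (hT : T.IsTree)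
    (hact : ∀ (g : Γ) (u w : V), T.Adj u w → T.Adj (g • u) (g • w))
    {k : ℕ} (hacyl : IsAcylindrical Γ T k) {U : Subgroup Γ} {F : Finset V}
    (hC : SetConn T (core U F)) (hF : F.Nonempty) : SetConn T (hull U F) := by
  intro f hf
  have hfC := hC f fun u hu w hw => hf u (core_subset_hull U F hu) w (core_subset_hull U F hw)
  have key : ∀ q ∈ hull U F, ∃ p ∈ core U F, (f p ↔ f q) := by
    intro q hq
    obtain ⟨p, hp, w, -, hw⟩ := exists_walk_of_mem_hull hT hact hacyl hC hF hq
    have := SetConn.of_walk w f fun u hu z hz => hf u (hw u hu) z (hw z hz)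
    exact ⟨p, hp, this p (by simp) q (by simp), this q (by simp) p (by simp)⟩
  intro u hu w hw h
  obtain ⟨p, hp, hpu⟩ := key u hu
  obtain ⟨p', hp', hpw⟩ := key w hw
  exact hpw.mp (hfC p hp p' hp' (hpu.mpr h))

end Hull

section Merge

variable {V : Type v} {Γ : Type u} [Group Γ] [MulAction Γ V] {T : SimpleGraph V}

theorem setConn_core_closure (hact : ∀ (g : Γ) (u w : V), T.Adj u w → T.Adj (g • u) (g • w))
    {S : Set Γ} {F : Finset V} {C : Set V} (hC : SetConn T C) (hFC : (F : Set V) ⊆ C)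
    (hCF : C ⊆ core (Subgroup.closure S) F)
    (hS : ∀ s ∈ S, SetLinked T C {v | s⁻¹ • v ∈ C}) :
    SetConn T (core (Subgroup.closure S) F) := by
  convert hC.iUnion_closure hact S hS using 1
  ext v
  constructor
  · rintro ⟨g, hg, c, hc, rfl⟩
    exact ⟨g, hg, c, hFC hc, rfl⟩
  · rintro ⟨g, hg, c, hc, rfl⟩
    exact smul_mem_core hg (hCF hc)

theorem core_mono {U U' : Subgroup Γ} (hU : U ≤ U') {F F' : Finset V} (hF : F ⊆ F') :
    core U F ⊆ core U' F' := by
  rintro _ ⟨g, hg, c, hc, rfl⟩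
  exact ⟨g, hU hg, c, hF hc, rfl⟩

theorem setLinked_smul_core {U : Subgroup Γ} {F : Finset V} (hF : F.Nonempty) {C : Set V}
    (hC : core U F ⊆ C) {s : Γ} (hs : s ∈ U) : SetLinked T C {v | s⁻¹ • v ∈ C} := by
  obtain ⟨c, hc⟩ := hF
  have := subset_core U F hc
  exact ⟨c, hC this, c, hC (smul_mem_core (inv_mem hs) this), Or.inl rfl⟩

theorem exists_setConn_core_closure_insert (hT : T.IsTree)
    (hact : ∀ (g : Γ) (u w : V), T.Adj u w → T.Adj (g • u) (g • w))
    {k : ℕ} (hacyl : IsAcylindrical Γ T k) {U : Subgroup Γ} {F : Finset V}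
    (hC : SetConn T (core U F)) (hF : F.Nonempty) {c : Γ}
    (hc : SetLinked T (hull U F) {v | c⁻¹ • v ∈ hull U F}) (m : ℕ) (hm : U ≠ ⊥ → m = k) :
    ∃ F' : Finset V, F ⊆ F' ∧ F'.card ≤ F.card + 2 * m ∧
      SetConn T (core (Subgroup.closure (U ∪ {c} : Set Γ)) F') := by
  classical
  have hnear : ∀ q ∈ hull U F, ∃ p ∈ core U F, ∃ w : T.Walk p q, w.length ≤ m := by
    intro q hq
    by_cases hU : U = ⊥
    · exact ⟨q, by rwa [hull_eq_core_of_eq_bot hU] at hq, .nil, by simp⟩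
    · obtain ⟨p, hp, w, hw, -⟩ := exists_walk_of_mem_hull hT hact hacyl hC hF hq
      exact ⟨p, hp, w, (hm hU).symm ▸ hw⟩
  obtain ⟨x, hx, y, hy, hxy⟩ := hc
  obtain ⟨p, hp, w, hw⟩ := hnear x hx
  obtain ⟨p', hp', w', hw'⟩ := hnear _ hy
  let φ : T →g T := ⟨fun v => c • v, fun h => hact c _ _ h⟩
  let w'' : T.Walk (c • p') y := (w'.map φ).copy rfl (by simp [φ])
  have hw'' : w''.length ≤ m := by simpa [w''] using hw'
  obtain ⟨z, hz⟩ : ∃ z : T.Walk p (c • p'), z.length ≤ 2 * m + 1 := by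
    rcases hxy with rfl | hxy
    · exact ⟨w.append w''.reverse, by
        rw [SimpleGraph.Walk.length_append, SimpleGraph.Walk.length_reverse]; omega⟩
    · exact ⟨w.append (.cons hxy w''.reverse), by
        rw [SimpleGraph.Walk.length_append, SimpleGraph.Walk.length_cons,
          SimpleGraph.Walk.length_reverse]; omega⟩
  obtain ⟨D, hD, hDconn⟩ := z.exists_setConn_insert_insert (2 * m) hz
  have hUle : U ≤ Subgroup.closure (U ∪ {c} : Set Γ) := fun u hu =>
    Subgroup.subset_closure (Or.inl hu)
  have hcle : c ∈ Subgroup.closure (U ∪ {c} : Set Γ) := Subgroup.subset_closure (Or.inr rfl)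
  refine ⟨F ∪ D, Finset.subset_union_left, (Finset.card_union_le _ _).trans (by omega), ?_⟩
  have hFD := core_mono hUle (Finset.subset_union_left (s₁ := F) (s₂ := D))
  refine setConn_core_closure hact (C := core U F ∪ ({p, c • p'} ∪ (D : Set V)))
    (hC.union hDconn ⟨p, hp, p, by simp, Or.inl rfl⟩) ?_ ?_ ?_
  · rw [Finset.coe_union]
    exact Set.union_subset_union (subset_core U F) Set.subset_union_right
  · refine Set.union_subset hFD (Set.union_subset ?_ ?_)
    · rintro v (rfl | rfl)
      · exact hFD hp
      · exact smul_mem_core hcle (hFD hp')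
    · exact (Finset.coe_subset.mpr Finset.subset_union_right).trans (subset_core _ _)
  · rintro s (hs | rfl)
    · exact setLinked_smul_core hF Set.subset_union_left hs
    · exact ⟨s • p', by simp, s • p', by simp [hp'], Or.inl rfl⟩

theorem exists_setConn_core_closure_union (hT : T.IsTree)
    (hact : ∀ (g : Γ) (u w : V), T.Adj u w → T.Adj (g • u) (g • w))
    {k : ℕ} (hk : 1 ≤ k) (hacyl : IsAcylindrical Γ T k) {U U' : Subgroup Γ} {F F' : Finset V}
    (hC : SetConn T (core U F)) (hF : F.Nonempty) (hC' : SetConn T (core U' F'))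
    (hF' : F'.Nonempty) {q : V} (hq : q ∈ hull U F) (hq' : q ∈ hull U' F') :
    ∃ F'' : Finset V, F ⊆ F'' ∧ F' ⊆ F'' ∧ F''.card + 1 ≤ F.card + F'.card + 2 * k ∧
      SetConn T (core (Subgroup.closure (U ∪ U' : Set Γ)) F'') := by
  classical
  obtain ⟨p, hp, w, hw, -⟩ := exists_walk_of_mem_hull hT hact hacyl hC hF hq
  obtain ⟨p', hp', w', hw', -⟩ := exists_walk_of_mem_hull hT hact hacyl hC' hF' hq'
  obtain ⟨D, hD, hDconn⟩ := (w.append w'.reverse).exists_setConn_insert_insert (2 * k - 1) (by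
    rw [SimpleGraph.Walk.length_append, SimpleGraph.Walk.length_reverse]; omega)
  have hUle : U ≤ Subgroup.closure (U ∪ U' : Set Γ) := fun u hu =>
    Subgroup.subset_closure (Or.inl hu)
  have hUle' : U' ≤ Subgroup.closure (U ∪ U' : Set Γ) := fun u hu =>
    Subgroup.subset_closure (Or.inr hu)
  have h1 : F ⊆ F ∪ F' ∪ D := Finset.subset_union_left.trans Finset.subset_union_left
  have h2 : F' ⊆ F ∪ F' ∪ D := Finset.subset_union_right.trans Finset.subset_union_left
  refine ⟨F ∪ F' ∪ D, h1, h2, ?_, ?_⟩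
  · have := Finset.card_union_le (F ∪ F') D
    have := Finset.card_union_le F F'
    omega
  refine setConn_core_closure hact (C := core U F ∪ ({p, p'} ∪ (D : Set V)) ∪ core U' F')
    ((hC.union hDconn ⟨p, hp, p, by simp, Or.inl rfl⟩).union hC'
      ⟨p', by simp, p', hp', Or.inl rfl⟩) ?_ ?_ ?_
  · intro v hv
    simp only [Finset.coe_union] at hv
    rcases hv with (hv | hv) | hv
    · exact Or.inl (Or.inl (subset_core _ _ hv))
    · exact Or.inr (subset_core _ _ hv)
    · exact Or.inl (Or.inr (Or.inr hv))
  · refine Set.union_subset (Set.union_subset (core_mono hUle h1) (Set.union_subset ?_ ?_))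
      (core_mono hUle' h2)
    · rintro v (rfl | rfl)
      · exact core_mono hUle h1 hp
      · exact core_mono hUle' h2 hp'
    · exact (Finset.coe_subset.mpr Finset.subset_union_right).trans (subset_core _ _)
  · rintro s (hs | hs)
    · exact setLinked_smul_core hF (fun v hv => Or.inl (Or.inl hv)) hs
    · exact setLinked_smul_core hF' (fun v hv => Or.inr hv) hs

/-- The conjugate of `U` stabilizing the translate by `d`. -/
def conjSubgroup (d : Γ) (U : Subgroup Γ) : Subgroup Γ := U.map (MulAut.conj d).toMonoidHom

theorem mem_conjSubgroup {d g : Γ} {U : Subgroup Γ} : g ∈ conjSubgroup d U ↔ d⁻¹ * g * d ∈ U := by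
  constructor
  · rintro ⟨u, hu, rfl⟩
    simpa [mul_assoc] using hu
  · intro h
    exact ⟨_, h, by simp [mul_assoc]⟩

theorem mem_core_conjSubgroup [DecidableEq V] {d : Γ} {U : Subgroup Γ} {F : Finset V} {v : V} :
    v ∈ core (conjSubgroup d U) (F.image (d • ·)) ↔ d⁻¹ • v ∈ core U F := by
  constructor
  · rintro ⟨g, hg, c, hc, rfl⟩
    obtain ⟨c, hcF, rfl⟩ := Finset.mem_image.mp (Finset.mem_coe.mp hc)
    exact ⟨_, mem_conjSubgroup.mp hg, c, hcF, by simp [mul_smul]⟩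
  · rintro ⟨g, hg, c, hc, h⟩
    rw [inv_smul_eq_iff] at h
    subst h
    exact ⟨d * g * d⁻¹, mem_conjSubgroup.mpr (by simpa [mul_assoc] using hg), d • c,
      by simpa using hc, by simp [mul_smul]⟩

theorem mem_hull_conjSubgroup [DecidableEq V] {d : Γ} {U : Subgroup Γ} {F : Finset V} {v : V} :
    v ∈ hull (conjSubgroup d U) (F.image (d • ·)) ↔ d⁻¹ • v ∈ hull U F := by
  refine or_congr mem_core_conjSubgroup ⟨?_, ?_⟩
  · rintro ⟨g, hg, h1, hv⟩
    exact ⟨_, mem_conjSubgroup.mp hg, by simpa [mul_assoc, mul_eq_one_iff_eq_inv] using h1,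
      by simp [mul_smul, hv]⟩
  · rintro ⟨g, hg, h1, hv⟩
    refine ⟨d * g * d⁻¹, mem_conjSubgroup.mpr (by simpa [mul_assoc] using hg), by simpa using h1, ?_⟩
    rw [mul_smul, mul_smul, hv, smul_inv_smul]

end Merge

/-- A finite family of pieces `hull (grp i) (fin i)`, indexed by `idx`, whose translates are glued
to one another. A pair `(i, g)` stands for the translate by `g` of the piece `i`. -/
structure Pieces (V : Type v) (Γ : Type u) [Group Γ] (ι : Type*) where
  /-- the indices in use -/
  idx : Finset ι
  /-- the group acting on a piece -/
  grp : ι → Subgroup Γ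
  /-- the vertices generating a piece -/
  fin : ι → Finset V

namespace Pieces

variable {V : Type v} {Γ : Type u} [Group Γ] {T : SimpleGraph V} {ι : Type*}

/-- Translation of the index of a translate. -/
def translate (g : Γ) (t : ι × Γ) : ι × Γ := (t.1, g * t.2)

@[simp] theorem translate_fst (g : Γ) (t : ι × Γ) : (translate g t).1 = t.1 := rfl

theorem translate_translate (g h : Γ) (t : ι × Γ) :
    translate g (translate h t) = translate (g * h) t := by
  simp [translate, mul_assoc]

/-- Gluing along the pairs in `J` connects all the translates. -/
def Conn (P : Pieces V Γ ι) (J : Set ((ι × Γ) × (ι × Γ))) : Prop :=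
  ∀ f : ι × Γ → Prop, (∀ i g, ∀ u ∈ P.grp i, (f (i, g) ↔ f (i, g * u))) →
    (∀ e ∈ J, ∀ g, (f (translate g e.1) ↔ f (translate g e.2))) →
    ∀ s t : ι × Γ, s.1 ∈ P.idx → t.1 ∈ P.idx → (f s ↔ f t)

theorem conn_insert_swap {P : Pieces V Γ ι} {J : Set ((ι × Γ) × (ι × Γ))} {α β : ι × Γ}
    (h : P.Conn (insert (α, β) J)) : P.Conn (insert (β, α) J) := by
  intro f h1 h2
  refine h f h1 ?_
  rintro e (rfl | he) g
  · exact (h2 _ (Or.inl rfl) g).symm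
  · exact h2 e (Or.inr he) g

variable [MulAction Γ V]

/-- The translate of a piece. -/
def piece (P : Pieces V Γ ι) (t : ι × Γ) : Set V :=
  {v | t.2⁻¹ • v ∈ hull (P.grp t.1) (P.fin t.1)}

theorem smul_mem_piece_translate {P : Pieces V Γ ι} {g : Γ} {t : ι × Γ} {v : V} :
    g • v ∈ P.piece (translate g t) ↔ v ∈ P.piece t := by
  simp [piece, translate, mul_smul]

/-- The pieces in use are generated by connected sets, and trivial groups have single generating
vertices. -/
structure Good (T : SimpleGraph V) (P : Pieces V Γ ι) : Prop where
  idx_nonempty : P.idx.Nonempty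
  fin_nonempty : ∀ i ∈ P.idx, (P.fin i).Nonempty
  setConn : ∀ i ∈ P.idx, SetConn T (core (P.grp i) (P.fin i))
  card_eq : ∀ i ∈ P.idx, P.grp i = ⊥ → (P.fin i).card = 1

/-- The pairs in `J` join adjacent vertices of translates of pieces in use. -/
def IsLinkSet (T : SimpleGraph V) (P : Pieces V Γ ι) (J : Finset ((ι × Γ) × (ι × Γ))) : Prop :=
  ∀ e ∈ J, e.1.1 ∈ P.idx ∧ e.2.1 ∈ P.idx ∧ ∃ x ∈ P.piece e.1, ∃ y ∈ P.piece e.2, T.Adj x y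

open scoped Classical in
/-- The contribution of a piece to the complexity. -/
noncomputable def weight (P : Pieces V Γ ι) (k : ℕ) (i : ι) : ℤ :=
  if P.grp i = ⊥ then -(2 * k) else (P.fin i).card - 1

/-- A good family of pieces, connected by few links. -/
structure Legal (T : SimpleGraph V) (P : Pieces V Γ ι) (k : ℕ) (N : ℤ)
    (J : Finset ((ι × Γ) × (ι × Γ))) : Prop where
  good : P.Good T
  isLinkSet : P.IsLinkSet T J
  conn : P.Conn J
  weight_le : ∑ i ∈ P.idx, P.weight k i + 2 * k * J.card ≤ N

theorem Legal.transport {P P' : Pieces V Γ ι} {k : ℕ} {N : ℤ} (σ : ι → ι) (c : ι → Γ)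
    (hσ : ∀ i ∈ P.idx, σ i ∈ P'.idx) (hsurj : ∀ i' ∈ P'.idx, ∃ i ∈ P.idx, σ i = i')
    (hgrp : ∀ i, ∀ u ∈ P.grp i, (c i)⁻¹ * u * c i ∈ P'.grp (σ i))
    (hfin : ∀ i ∈ P.idx, ∀ v ∈ P.fin i, (c i)⁻¹ • v ∈ hull (P'.grp (σ i)) (P'.fin (σ i)))
    {J : Finset ((ι × Γ) × (ι × Γ))} (hJ : P.IsLinkSet T J) {α β : ι × Γ}
    (hconn : P.Conn (insert (α, β) (J : Set _))) (hσαβ : σ α.1 = σ β.1)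
    (hαβ : (α.2 * c α.1)⁻¹ * (β.2 * c β.1) ∈ P'.grp (σ α.1)) (hgood : P'.Good T)
    (hw : ∑ i ∈ P'.idx, P'.weight k i + 2 * k * J.card ≤ N) :
    ∃ J', P'.Legal T k N J' ∧ J'.card ≤ J.card := by
  classical
  let ρ : ι × Γ → ι × Γ := fun t => (σ t.1, t.2 * c t.1)
  have hρ : ∀ g t, ρ (translate g t) = translate g (ρ t) := fun g t => by
    simp [ρ, translate, mul_assoc]
  have hcard : (J.image (Prod.map ρ ρ)).card ≤ J.card := Finset.card_image_le
  have hpiece : ∀ t : ι × Γ, t.1 ∈ P.idx → ∀ v ∈ P.piece t, v ∈ P'.piece (ρ t) := by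
    intro t ht v hv
    have key : (ρ t).2⁻¹ • v = (c t.1)⁻¹ • t.2⁻¹ • v := by simp [ρ, mul_smul]
    change (ρ t).2⁻¹ • v ∈ hull (P'.grp (ρ t).1) (P'.fin (ρ t).1)
    rw [key]
    rcases hv with ⟨u, hu, f, hf, hv⟩ | ⟨u, hu, h1, hv⟩
    · rw [hv]
      have := smul_mem_hull (hgrp _ u hu) (hfin _ ht f hf)
      simpa [mul_smul] using this
    · refine Or.inr ⟨_, hgrp _ u hu, ?_, ?_⟩
      · intro h
        apply h1
        rw [mul_assoc, inv_mul_eq_one] at h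
        exact (mul_eq_right.mp h.symm)
      · rw [mul_smul, mul_smul, smul_inv_smul, hv]
  refine ⟨J.image (Prod.map ρ ρ), ⟨hgood, ?_, ?_, ?_⟩, hcard⟩
  · intro e he
    obtain ⟨e, heJ, rfl⟩ := Finset.mem_image.mp he
    obtain ⟨h1, h2, x, hx, y, hy, hxy⟩ := hJ e heJ
    exact ⟨hσ _ h1, hσ _ h2, x, hpiece _ h1 x hx, y, hpiece _ h2 y hy, hxy⟩
  · intro f hf1 hf2 s t hs ht
    have hf : ∀ s t : ι × Γ, s.1 ∈ P.idx → t.1 ∈ P.idx → (f (ρ s) ↔ f (ρ t)) := by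
      refine hconn (fun t => f (ρ t)) ?_ ?_
      · intro i g u hu
        have := hf1 (σ i) (g * c i) _ (hgrp i u hu)
        simpa [ρ, mul_assoc] using this
      · rintro e (rfl | he) g
        · have := hf1 (σ α.1) (g * (α.2 * c α.1)) _ hαβ
          simpa [ρ, translate, mul_assoc, hσαβ] using this
        · simp only [hρ]
          exact hf2 (Prod.map ρ ρ e) (Finset.mem_coe.mpr (Finset.mem_image_of_mem _ he)) g
    have hlift : ∀ s : ι × Γ, s.1 ∈ P'.idx → ∃ s' : ι × Γ, s'.1 ∈ P.idx ∧ ρ s' = s := by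
      rintro ⟨i', g⟩ hi'
      obtain ⟨i, hi, rfl⟩ := hsurj i' hi'
      exact ⟨(i, g * (c i)⁻¹), hi, by simp [ρ]⟩
    obtain ⟨s', hs', rfl⟩ := hlift s hs
    obtain ⟨t', ht', rfl⟩ := hlift t ht
    exact hf s' t' hs' ht'
  · have : (2 * k * (J.image (Prod.map ρ ρ)).card : ℤ) ≤ 2 * k * J.card := by
      have : ((J.image (Prod.map ρ ρ)).card : ℤ) ≤ J.card := by exact_mod_cast hcard
      gcongr
    linarith

/-- Two translates of the same piece at distance at most one may be identified. -/
theorem Good.exists_legal_of_fst_eq (hT : T.IsTree)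
    (hact : ∀ (g : Γ) (u w : V), T.Adj u w → T.Adj (g • u) (g • w))
    {k : ℕ} (hacyl : IsAcylindrical Γ T k) {N : ℤ} {P : Pieces V Γ ι} (hP : P.Good T)
    {J : Finset ((ι × Γ) × (ι × Γ))} (hJ : P.IsLinkSet T J) {α β : ι × Γ} (hα : α.1 ∈ P.idx)
    (hconn : P.Conn (insert (α, β) (J : Set _)))
    (hw : ∑ i ∈ P.idx, P.weight k i + 2 * k * (J.card + 1) ≤ N) (hαβ : α.1 = β.1)
    (hlink : SetLinked T (P.piece α) (P.piece β)) :
    ∃ (P' : Pieces V Γ ι) (J' : _), P'.Legal T k N J' ∧ J'.card ≤ J.card := by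
  classical
  obtain ⟨i, b⟩ := α
  obtain ⟨i', b'⟩ := β
  obtain rfl : i = i' := hαβ
  change i ∈ P.idx at hα
  by_cases hc : b⁻¹ * b' ∈ P.grp i
  · refine ⟨P, Legal.transport (P := P) (P' := P) id 1 (fun i hi => hi) (fun i hi => ⟨i, hi, rfl⟩)
      (by simp) ?_ hJ hconn rfl (by simpa using hc) hP ?_⟩
    · intro j hj v hv
      simpa using core_subset_hull _ _ (subset_core _ _ hv)
    · have : (0 : ℤ) ≤ 2 * k := by positivity
      linarith
  have hlink' : SetLinked T (hull (P.grp i) (P.fin i))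
      {v | (b⁻¹ * b')⁻¹ • v ∈ hull (P.grp i) (P.fin i)} := by
    obtain ⟨x, hx, y, hy, hxy⟩ := hlink
    refine ⟨b⁻¹ • x, hx, b⁻¹ • y, ?_, hxy.imp (congrArg _) (hact _ _ _)⟩
    have : b'⁻¹ • y ∈ hull (P.grp i) (P.fin i) := hy
    simpa [mul_smul] using this
  set m := if P.grp i = ⊥ then 0 else k with hm
  obtain ⟨F', hFF', hcard, hconn'⟩ := exists_setConn_core_closure_insert hT hact hacyl
    (hP.setConn i hα) (hP.fin_nonempty i hα) hlink' m (fun h => by simp [hm, h])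
  set U' := Subgroup.closure (P.grp i ∪ {b⁻¹ * b'} : Set Γ) with hU'
  have hUU' : P.grp i ≤ U' := fun u hu => Subgroup.subset_closure (Or.inl hu)
  have hcU' : b⁻¹ * b' ∈ U' := Subgroup.subset_closure (Or.inr rfl)
  have hU'1 : U' ≠ ⊥ := by
    intro h
    rw [h, Subgroup.mem_bot] at hcU'
    exact hc (hcU' ▸ one_mem _)
  let P' : Pieces V Γ ι := ⟨P.idx, Function.update P.grp i U', Function.update P.fin i F'⟩
  refine ⟨P', Legal.transport (P := P) (P' := P') id 1 (fun i hi => hi) (fun i hi => ⟨i, hi, rfl⟩)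
      ?_ ?_ hJ hconn rfl (by simpa [P'] using hcU') ?_ ?_⟩
  · intro j u hu
    by_cases hj : j = i
    · subst hj; simpa [P'] using hUU' hu
    · simpa [P', hj] using hu
  · intro j _ v hv
    refine core_subset_hull _ _ (subset_core _ _ ?_)
    by_cases hj : j = i
    · subst hj; simpa [P'] using hFF' hv
    · simpa [P', hj] using hv
  · refine ⟨hP.idx_nonempty, ?_, ?_, ?_⟩
    · intro j hjI
      by_cases hj : j = i
      · subst hj; simpa [P'] using (hP.fin_nonempty j hα).mono hFF'
      · simpa [P', hj] using hP.fin_nonempty j hjI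
    · intro j hjI
      by_cases hj : j = i
      · subst hj; simpa [P'] using hconn'
      · simpa [P', hj] using hP.setConn j hjI
    · intro j hjI hbot
      by_cases hj : j = i
      · subst hj; simp [P', hU'1] at hbot
      · simp only [P', ne_eq, hj, not_false_eq_true, Function.update_of_ne] at hbot ⊢
        exact hP.card_eq j hjI hbot
  · have h1 : ∑ j ∈ P.idx.erase i, P'.weight k j = ∑ j ∈ P.idx.erase i, P.weight k j := by
      refine Finset.sum_congr rfl fun j hj => ?_
      simp [weight, P', Finset.ne_of_mem_erase hj]
    have h2 : P'.weight k i ≤ P.weight k i + 2 * k := by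
      have hc' : (F'.card : ℤ) ≤ (P.fin i).card + 2 * m := by exact_mod_cast hcard
      by_cases hb : P.grp i = ⊥
      · have := hP.card_eq i hα hb
        simp [weight, P', hU'1, hb, hm, this] at hc' ⊢
        linarith
      · simp [weight, P', hU'1, hb, hm] at hc' ⊢
        linarith
    change ∑ j ∈ P.idx, P'.weight k j + _ ≤ _
    rw [← Finset.add_sum_erase _ _ hα] at hw ⊢
    linarith

/-- Merging a piece with trivial group into another one, or two pieces with nontrivial groups. -/
theorem Good.exists_legal_of_fst_ne (hT : T.IsTree)
    (hact : ∀ (g : Γ) (u w : V), T.Adj u w → T.Adj (g • u) (g • w))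
    {k : ℕ} (hk : 1 ≤ k) (hacyl : IsAcylindrical Γ T k) {N : ℤ} {P : Pieces V Γ ι}
    (hP : P.Good T) {J : Finset ((ι × Γ) × (ι × Γ))} (hJ : P.IsLinkSet T J) {α β : ι × Γ}
    (hα : α.1 ∈ P.idx) (hβ : β.1 ∈ P.idx) (hconn : P.Conn (insert (α, β) (J : Set _)))
    (hw : ∑ i ∈ P.idx, P.weight k i + 2 * k * (J.card + 1) ≤ N) (hαβ : α.1 ≠ β.1)
    (hinter : (P.piece α ∩ P.piece β).Nonempty)
    (hbot : P.grp β.1 = ⊥ ∨ (P.grp α.1 ≠ ⊥ ∧ P.grp β.1 ≠ ⊥)) :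
    ∃ (P' : Pieces V Γ ι) (J' : _), P'.Legal T k N J' ∧ J'.card ≤ J.card := by
  classical
  obtain ⟨i, b⟩ := α
  obtain ⟨i', b'⟩ := β
  change i ∈ P.idx at hα
  change i' ∈ P.idx at hβ
  change i ≠ i' at hαβ
  change P.grp i' = ⊥ ∨ (P.grp i ≠ ⊥ ∧ P.grp i' ≠ ⊥) at hbot
  set d := b⁻¹ * b' with hd
  obtain ⟨q, hq, hq'⟩ := hinter
  replace hq : b⁻¹ • q ∈ hull (P.grp i) (P.fin i) := hq
  replace hq' : b⁻¹ • q ∈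
      hull (conjSubgroup d (P.grp i')) ((P.fin i').image (d • ·)) := by
    rw [mem_hull_conjSubgroup, hd]
    have : b'⁻¹ • q ∈ hull (P.grp i') (P.fin i') := hq'
    simpa [mul_smul] using this
  obtain ⟨U, F, hFne, hFconn, hFcard, hUi, hFi, hUi', hFi', hweight⟩ :
      ∃ (U : Subgroup Γ) (F : Finset V), F.Nonempty ∧ SetConn T (core U F) ∧
        (U = ⊥ → F.card = 1) ∧ P.grp i ≤ U ∧ (P.fin i : Set V) ⊆ hull U F ∧
        (∀ u ∈ P.grp i', d * u * d⁻¹ ∈ U) ∧ (∀ v ∈ P.fin i', d • v ∈ hull U F) ∧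
        (if U = ⊥ then -(2 * k : ℤ) else F.card - 1) ≤
          P.weight k i + P.weight k i' + 2 * k := by
    rcases hbot with hb' | ⟨hb, hb'⟩
    · refine ⟨P.grp i, P.fin i, hP.fin_nonempty i hα, hP.setConn i hα, hP.card_eq i hα,
        le_rfl, (subset_core _ _).trans (core_subset_hull _ _), ?_, ?_, ?_⟩
      · intro u hu
        rw [hb', Subgroup.mem_bot] at hu
        simp [hu]
      · intro v hv
        obtain ⟨f, hf⟩ := Finset.card_eq_one.mp (hP.card_eq i' hβ hb')
        rw [hf, Finset.mem_singleton] at hv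
        subst hv
        rw [mem_hull_conjSubgroup, hb', hull_bot, hf] at hq'
        have : d⁻¹ • b⁻¹ • q = v := by simpa using hq'
        rw [← this, smul_inv_smul]
        exact hq
      · simp only [weight, hb', if_true]
        linarith
    · have hconj : SetConn T (core (conjSubgroup d (P.grp i')) ((P.fin i').image (d • ·))) := by
        have := (hP.setConn i' hβ).preimage_smul hact d⁻¹
        convert this using 1
        ext v
        exact mem_core_conjSubgroup
      obtain ⟨F, h1, h2, h3, h4⟩ := exists_setConn_core_closure_union hT hact hk hacyl
        (hP.setConn i hα) (hP.fin_nonempty i hα) hconj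
        ((hP.fin_nonempty i' hβ).image _) hq hq'
      have hUU : P.grp i ≤ Subgroup.closure (P.grp i ∪ conjSubgroup d (P.grp i') : Set Γ) :=
        fun u hu => Subgroup.subset_closure (Or.inl hu)
      have hUne : Subgroup.closure (P.grp i ∪ conjSubgroup d (P.grp i') : Set Γ) ≠ ⊥ := fun h =>
        hb (le_bot_iff.mp (h ▸ hUU))
      refine ⟨_, F, (hP.fin_nonempty i hα).mono h1, h4, fun h => absurd h hUne, hUU,
        (Finset.coe_subset.mpr h1).trans ((subset_core _ _).trans (core_subset_hull _ _)),
        ?_, ?_, ?_⟩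
      · intro u hu
        exact Subgroup.subset_closure (Or.inr (mem_conjSubgroup.mpr (by simpa [mul_assoc] using hu)))
      · intro v hv
        exact core_subset_hull _ _ (subset_core _ _ (h2 (Finset.mem_image_of_mem _ hv)))
      · have h5 : ((P.fin i').image (d • ·)).card ≤ (P.fin i').card := Finset.card_image_le
        have h6 : (F.card : ℤ) + 1 ≤ (P.fin i).card + (P.fin i').card + 2 * k := by
          exact_mod_cast h3.trans (by omega)
        simp only [weight, hb, hb', hUne, if_false]
        linarith
  let P' : Pieces V Γ ι :=
    ⟨P.idx.erase i', Function.update P.grp i U, Function.update P.fin i F⟩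
  have hiI : i ∈ P.idx.erase i' := Finset.mem_erase.mpr ⟨hαβ, hα⟩
  refine ⟨P', Legal.transport (P := P) (P' := P') (Function.update id i' i) (Function.update 1 i' d⁻¹)
      ?_ ?_ ?_ ?_ hJ hconn ?_ ?_ ?_ ?_⟩
  · intro j hj
    by_cases hj' : j = i'
    · subst hj'; simpa [P'] using ⟨hαβ, hα⟩
    · simpa [P', hj'] using hj
  · intro j hj
    obtain ⟨h1, h2⟩ := Finset.mem_erase.mp hj
    exact ⟨j, h2, by simp [h1]⟩
  · intro j u hu
    by_cases hj' : j = i'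
    · subst hj'; simpa [P'] using hUi' u hu
    · by_cases hj : j = i
      · subst hj; simpa [P', hj'] using hUi hu
      · simpa [P', hj', hj] using hu
  · intro j hjI v hv
    by_cases hj' : j = i'
    · subst hj'; simpa [P'] using hFi' v hv
    · by_cases hj : j = i
      · subst hj; simpa [P', hj'] using hFi hv
      · simpa [P', hj', hj] using core_subset_hull _ _ (subset_core _ _ hv)
  · simp [hαβ]
  · simp [hαβ, hd]
  · refine ⟨⟨i, hiI⟩, ?_, ?_, ?_⟩
    · intro j hjI
      by_cases hj : j = i
      · subst hj; simpa [P'] using hFne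
      · simpa [P', hj] using hP.fin_nonempty j (Finset.mem_of_mem_erase hjI)
    · intro j hjI
      by_cases hj : j = i
      · subst hj; simpa [P'] using hFconn
      · simpa [P', hj] using hP.setConn j (Finset.mem_of_mem_erase hjI)
    · intro j hjI hbot
      by_cases hj : j = i
      · subst hj
        simp only [P', Function.update_self] at hbot ⊢
        exact hFcard hbot
      · simp only [P', ne_eq, hj, not_false_eq_true, Function.update_of_ne] at hbot ⊢
        exact hP.card_eq j (Finset.mem_of_mem_erase hjI) hbot
  · have h1 : ∑ j ∈ (P.idx.erase i').erase i, P'.weight k j =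
        ∑ j ∈ (P.idx.erase i').erase i, P.weight k j := by
      refine Finset.sum_congr rfl fun j hj => ?_
      simp [weight, P', Finset.ne_of_mem_erase hj]
    have h2 : P'.weight k i ≤ P.weight k i + P.weight k i' + 2 * k := by
      simpa [weight, P'] using hweight
    change ∑ j ∈ P.idx.erase i', P'.weight k j + _ ≤ _
    rw [← Finset.add_sum_erase _ _ hβ, ← Finset.add_sum_erase _ _ hiI] at hw
    rw [← Finset.add_sum_erase _ _ hiI]
    linarith

theorem Good.exists_legal (hT : T.IsTree)
    (hact : ∀ (g : Γ) (u w : V), T.Adj u w → T.Adj (g • u) (g • w))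
    {k : ℕ} (hk : 1 ≤ k) (hacyl : IsAcylindrical Γ T k) {N : ℤ} {P : Pieces V Γ ι}
    (hP : P.Good T) {J : Finset ((ι × Γ) × (ι × Γ))} (hJ : P.IsLinkSet T J) {α β : ι × Γ}
    (hα : α.1 ∈ P.idx) (hβ : β.1 ∈ P.idx) (hconn : P.Conn (insert (α, β) (J : Set _)))
    (hw : ∑ i ∈ P.idx, P.weight k i + 2 * k * (J.card + 1) ≤ N)
    (h : (α.1 = β.1 ∧ SetLinked T (P.piece α) (P.piece β)) ∨
      (P.piece α ∩ P.piece β).Nonempty) :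
    ∃ (P' : Pieces V Γ ι) (J' : _), P'.Legal T k N J' ∧ J'.card ≤ J.card := by
  by_cases hαβ : α.1 = β.1
  · refine hP.exists_legal_of_fst_eq hT hact hacyl hJ hα hconn hw hαβ ?_
    rcases h with h | ⟨q, h, h'⟩
    · exact h.2
    · exact ⟨q, h, q, h', Or.inl rfl⟩
  · have hi := h.resolve_left fun h => hαβ h.1
    by_cases hbot : P.grp α.1 = ⊥
    · exact hP.exists_legal_of_fst_ne hT hact hk hacyl hJ hβ hα (conn_insert_swap hconn) hw
        (Ne.symm hαβ) (by rwa [Set.inter_comm]) (Or.inl hbot)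
    · refine hP.exists_legal_of_fst_ne hT hact hk hacyl hJ hα hβ hconn hw hαβ hi ?_
      by_cases hbot' : P.grp β.1 = ⊥
      · exact Or.inl hbot'
      · exact Or.inr ⟨hbot, hbot'⟩

end Pieces

theorem SimpleGraph.IsAcyclic.eq_of_reachable_of_locally_injective {V W : Type*}
    {T : SimpleGraph V} {S : SimpleGraph W} (hT : T.IsAcyclic) (f : S →g T)
    (hf : ∀ a b c, S.Adj b a → S.Adj b c → f a = f c → a = c) {a b : W} (h : S.Reachable a b)
    (hab : f a = f b) : a = b := by
  classical
  have key : ∀ {a b : W} (p : S.Walk a b), p.IsPath → (p.map f).edges.IsChain (· ≠ ·) := by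
    intro a b p
    induction p with
    | nil => simp
    | @cons a b c h p ih =>
      intro hp
      rw [SimpleGraph.Walk.cons_isPath_iff] at hp
      have ih := ih hp.1
      cases p with
      | nil => simp
      | @cons _ d _ h' p =>
        simp only [SimpleGraph.Walk.map_cons, SimpleGraph.Walk.edges_cons] at ih ⊢
        refine List.IsChain.cons_cons ?_ ih
        intro he
        rcases Sym2.eq_iff.mp he with h1 | h1
        · exact (f.map_adj h).ne h1.1
        · have := hf a b d h.symm h' h1.1
          subst this
          exact hp.2 (by simp)
  obtain ⟨p, hp⟩ := h.exists_isPath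
  have hpath := (hT.isPath_iff_isChain (p.map f)).mpr (key p hp)
  have hnil : (p.map f).length = 0 := by
    have h1 : ((p.map f).copy rfl hab.symm).IsPath := by
      rwa [SimpleGraph.Walk.isPath_copy]
    rw [SimpleGraph.Walk.isPath_iff_nil, ← SimpleGraph.Walk.length_eq_zero_iff] at h1
    rwa [SimpleGraph.Walk.length_copy] at h1
  rw [SimpleGraph.Walk.length_map] at hnil
  exact SimpleGraph.Walk.eq_of_length_eq_zero hnil

namespace Pieces

section Node

variable {V : Type v} {Γ : Type u} [Group Γ] {ι : Type*}

/-- The pairs `t` denoting the same translate as `s`. -/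
def node (P : Pieces V Γ ι) (s : ι × Γ) : Set (ι × Γ) :=
  {t | t.1 = s.1 ∧ s.2⁻¹ * t.2 ∈ P.grp s.1}

theorem mem_node_self (P : Pieces V Γ ι) (s : ι × Γ) : s ∈ P.node s := ⟨rfl, by simp⟩

theorem node_eq_iff {P : Pieces V Γ ι} {s t : ι × Γ} :
    P.node s = P.node t ↔ s.1 = t.1 ∧ t.2⁻¹ * s.2 ∈ P.grp t.1 := by
  constructor
  · intro h
    exact h.le (P.mem_node_self s)
  · obtain ⟨i, g⟩ := s
    obtain ⟨j, h⟩ := t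
    rintro ⟨h1, h2⟩
    obtain rfl : i = j := h1
    replace h2 : h⁻¹ * g ∈ P.grp i := h2
    ext ⟨l, m⟩
    refine and_congr_right fun _ => ?_
    change g⁻¹ * m ∈ P.grp i ↔ h⁻¹ * m ∈ P.grp i
    rw [show h⁻¹ * m = (h⁻¹ * g) * (g⁻¹ * m) by group]
    exact ((P.grp i).mul_mem_cancel_left h2).symm

theorem iff_of_node_eq {P : Pieces V Γ ι} {f : ι × Γ → Prop}
    (hf : ∀ i g, ∀ u ∈ P.grp i, (f (i, g) ↔ f (i, g * u))) {s t : ι × Γ}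
    (h : P.node s = P.node t) : f s ↔ f t := by
  obtain ⟨i, g⟩ := s
  obtain ⟨j, h'⟩ := t
  obtain ⟨h1, h2⟩ := node_eq_iff.mp h
  obtain rfl : i = j := h1
  have := hf i h' _ h2
  simpa using this.symm

theorem node_translate {P : Pieces V Γ ι} {s t : ι × Γ} (h : P.node s = P.node t) (g : Γ) :
    P.node (translate g s) = P.node (translate g t) := by
  rw [node_eq_iff] at h ⊢
  simpa [translate, mul_assoc] using h

variable [MulAction Γ V]

theorem piece_eq_of_node_eq {P : Pieces V Γ ι} {s t : ι × Γ} (h : P.node s = P.node t) :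
    P.piece s = P.piece t := by
  have key : ∀ {s t : ι × Γ}, P.node s = P.node t → P.piece s ⊆ P.piece t := by
    rintro ⟨i, g⟩ ⟨j, h⟩ hn v hv
    obtain ⟨h1, h2⟩ := node_eq_iff.mp hn
    obtain rfl : i = j := h1
    have := smul_mem_hull h2 hv
    simpa [piece, mul_smul] using this
  exact (key h).antisymm (key h.symm)

end Node

variable {V : Type v} {Γ : Type u} [Group Γ] [MulAction Γ V] {T : SimpleGraph V} {ι : Type*}

theorem Good.setConn_piece (hT : T.IsTree)
    (hact : ∀ (g : Γ) (u w : V), T.Adj u w → T.Adj (g • u) (g • w))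
    {k : ℕ} (hacyl : IsAcylindrical Γ T k) {P : Pieces V Γ ι} (hP : P.Good T) {t : ι × Γ}
    (ht : t.1 ∈ P.idx) : SetConn T (P.piece t) :=
  (setConn_hull hT hact hacyl (hP.setConn _ ht) (hP.fin_nonempty _ ht)).preimage_smul hact _

/-- The oriented edge from `x` to `y` is a translate of the chosen edge for the pair `e`, and
`s`, `t` are the corresponding ends. -/
def IsTranslate (px py : (ι × Γ) × (ι × Γ) → V) (e : (ι × Γ) × (ι × Γ)) (s t : ι × Γ)
    (x y : V) : Prop :=
  (∃ g, s = translate g e.1 ∧ t = translate g e.2 ∧ x = g • px e ∧ y = g • py e) ∨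
    (∃ g, s = translate g e.2 ∧ t = translate g e.1 ∧ x = g • py e ∧ y = g • px e)

theorem IsTranslate.symm {px py : (ι × Γ) × (ι × Γ) → V} {e : (ι × Γ) × (ι × Γ)} {s t : ι × Γ}
    {x y : V} (h : IsTranslate px py e s t x y) : IsTranslate px py e t s y x := by
  rcases h with ⟨g, h1, h2, h3, h4⟩ | ⟨g, h1, h2, h3, h4⟩
  · exact Or.inr ⟨g, h2, h1, h4, h3⟩
  · exact Or.inl ⟨g, h2, h1, h4, h3⟩

theorem IsTranslate.forall_iff {px py : (ι × Γ) × (ι × Γ) → V} {e : (ι × Γ) × (ι × Γ)}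
    {s t : ι × Γ} {x y : V} (h : IsTranslate px py e s t x y) (f : ι × Γ → Prop) :
    (∀ g, (f (translate g s) ↔ f (translate g t))) ↔
      ∀ g, (f (translate g e.1) ↔ f (translate g e.2)) := by
  rcases h with ⟨a, rfl, rfl, -, -⟩ | ⟨a, rfl, rfl, -, -⟩
  · simp only [translate_translate]
    exact ⟨fun h g => by simpa using h (g * a⁻¹), fun h g => h (g * a)⟩
  · simp only [translate_translate]
    exact ⟨fun h g => by simpa using (h (g * a⁻¹)).symm, fun h g => (h (g * a)).symm⟩

/-- The graph whose vertices are the vertices of the translates of pieces, glued along the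
translates of links. -/
def pieceGraph (T : SimpleGraph V) (P : Pieces V Γ ι) (px py : (ι × Γ) × (ι × Γ) → V)
    (J : Finset ((ι × Γ) × (ι × Γ))) : SimpleGraph (Set (ι × Γ) × V) where
  Adj a b := T.Adj a.2 b.2 ∧ ∃ s t, a.1 = P.node s ∧ b.1 = P.node t ∧ a.2 ∈ P.piece s ∧
    b.2 ∈ P.piece t ∧ (P.node s = P.node t ∨ ∃ e ∈ J, IsTranslate px py e s t a.2 b.2)
  symm := ⟨by
    rintro a b ⟨hab, s, t, h1, h2, h3, h4, h5⟩
    exact ⟨hab.symm, t, s, h2, h1, h4, h3,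
      h5.imp Eq.symm fun ⟨e, he, h⟩ => ⟨e, he, h.symm⟩⟩⟩
  loopless := ⟨fun _ h => h.1.ne rfl⟩

theorem Legal.eq_empty_of_forall_card_le (hT : T.IsTree)
    (hact : ∀ (g : Γ) (u w : V), T.Adj u w → T.Adj (g • u) (g • w))
    {k : ℕ} (hk : 1 ≤ k) (hacyl : IsAcylindrical Γ T k)
    (hst : ∀ x y, T.Adj x y → ∃ g : Γ, g ≠ 1 ∧ g • x = x ∧ g • y = y) {N : ℤ}
    {P : Pieces V Γ ι} {J : Finset ((ι × Γ) × (ι × Γ))} (hL : P.Legal T k N J)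
    (hmin : ∀ (P' : Pieces V Γ ι) (J' : _), P'.Legal T k N J' → J.card ≤ J'.card) :
    J = ∅ := by
  classical
  have hred : ∀ e ∈ J, ∀ α β : ι × Γ, α.1 ∈ P.idx → β.1 ∈ P.idx →
      P.Conn (insert (α, β) (J.erase e : Set _)) →
      ((α.1 = β.1 ∧ SetLinked T (P.piece α) (P.piece β)) ∨
        (P.piece α ∩ P.piece β).Nonempty) → False := by
    intro e he α β hα hβ hconn h
    have hcard := Finset.card_erase_add_one he
    obtain ⟨P', J', hL', hJ'⟩ := hL.good.exists_legal (N := N) hT hact hk hacyl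
      (fun a ha => hL.isLinkSet a (Finset.mem_of_mem_erase ha)) hα hβ hconn
      (by have := hL.weight_le; rw [← hcard] at this; exact_mod_cast this) h
    have := hmin P' J' hL'
    omega
  have hconn_self : ∀ e ∈ J, P.Conn (insert (e.1, e.2) (J.erase e : Set _)) := by
    intro e he
    have : insert (e.1, e.2) (J.erase e : Set ((ι × Γ) × (ι × Γ))) = J := by
      rw [Prod.mk.eta, ← Finset.coe_insert, Finset.insert_erase he]
    rw [this]
    exact hL.conn
  have hself : ∀ e ∈ J, e.1.1 ≠ e.2.1 := by
    intro e he heq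
    obtain ⟨h1, h2, x, hx, y, hy, hxy⟩ := hL.isLinkSet e he
    exact hred e he e.1 e.2 h1 h2 (hconn_self e he)
      (Or.inl ⟨heq, x, hx, y, hy, Or.inr hxy⟩)
  have hdisj : ∀ e ∈ J, ∀ v ∈ P.piece e.1, v ∉ P.piece e.2 := by
    intro e he v hv hv'
    obtain ⟨h1, h2, -⟩ := hL.isLinkSet e he
    exact hred e he e.1 e.2 h1 h2 (hconn_self e he) (Or.inr ⟨v, hv, hv'⟩)
  have : Nonempty V := hT.connected.nonempty
  have hpos := fun e he => (hL.isLinkSet e he).2.2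
  choose! px hpx py hpy hadj using hpos
  have hidx : ∀ e ∈ J, ∀ s t x y, IsTranslate px py e s t x y → t.1 ∈ P.idx ∧ y ∈ P.piece t := by
    rintro e he s t x y (⟨g, rfl, rfl, rfl, rfl⟩ | ⟨g, rfl, rfl, rfl, rfl⟩)
    · exact ⟨(hL.isLinkSet e he).2.1, smul_mem_piece_translate.mpr (hpy e he)⟩
    · exact ⟨(hL.isLinkSet e he).1, smul_mem_piece_translate.mpr (hpx e he)⟩
  have hnot : ∀ e ∈ J, ∀ s t x y, IsTranslate px py e s t x y → y ∉ P.piece s := by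
    rintro e he s t x y (⟨g, rfl, rfl, rfl, rfl⟩ | ⟨g, rfl, rfl, rfl, rfl⟩)
    · rw [smul_mem_piece_translate]
      exact fun h => hdisj e he _ h (hpy e he)
    · rw [smul_mem_piece_translate]
      exact hdisj e he _ (hpx e he)
  have hsmul : ∀ (s : ι × Γ) (g h : Γ), P.node (translate g s) = P.node (translate h s) →
      g ≠ h → ∀ v, g • v = h • v → v ∈ P.piece s := by
    intro s g h hn hne v hv
    have hm := (node_eq_iff.mp hn).2
    refine Or.inr ⟨_, hm, ?_, ?_⟩
    · intro h0
      rw [inv_mul_eq_one] at h0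
      exact hne (mul_right_cancel h0).symm
    · simp [translate, mul_smul, hv]
  have hinj : ∀ e ∈ J, ∀ e' ∈ J, ∀ s t s' t' x y, IsTranslate px py e s t x y →
      IsTranslate px py e' s' t' x y → P.node s = P.node s' → P.node t = P.node t' := by
    intro e he e' he' s t s' t' x y h h' hs
    by_cases hee : e = e'
    · subst hee
      rcases h with ⟨g, rfl, rfl, rfl, rfl⟩ | ⟨g, rfl, rfl, rfl, rfl⟩ <;>
        rcases h' with ⟨h, rfl, rfl, h1, h2⟩ | ⟨h, rfl, rfl, h1, h2⟩
      · by_cases hgh : g = h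
        · rw [hgh]
        · exact absurd (hpy e he) (hdisj e he _ (hsmul _ _ _ hs hgh _ h2))
      · exact absurd (node_eq_iff.mp hs).1 (hself e he)
      · exact absurd (node_eq_iff.mp hs).1.symm (hself e he)
      · by_cases hgh : g = h
        · rw [hgh]
        · exact absurd (hsmul _ _ _ hs hgh _ h2) (hdisj e he _ (hpx e he))
    · obtain ⟨ht, hy⟩ := hidx e he s t x y h
      obtain ⟨ht', hy'⟩ := hidx e' he' s' t' x y h'
      refine (hred e' he' t t' ht ht' ?_ (Or.inr ⟨y, hy, hy'⟩)).elim
      intro f hf1 hf2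
      refine hL.conn f hf1 fun a ha => ?_
      by_cases hae : a = e'
      · subst hae
        rw [← h'.forall_iff]
        intro g
        have h1 := (h.forall_iff f).mpr
          (hf2 e (Or.inr (Finset.mem_coe.mpr (Finset.mem_erase.mpr ⟨hee, he⟩)))) g
        have h2 := hf2 (t, t') (Or.inl rfl) g
        have h3 := iff_of_node_eq hf1 (node_translate hs g)
        exact h3.symm.trans (h1.trans h2)
      · exact hf2 a (Or.inr (Finset.mem_coe.mpr (Finset.mem_erase.mpr ⟨hae, ha⟩)))
  let S := pieceGraph T P px py J
  let φ : S →g T := ⟨Prod.snd, fun h => h.1⟩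
  have hloc : ∀ a b c, S.Adj b a → S.Adj b c → φ a = φ c → a = c := by
    rintro ⟨a, y⟩ ⟨b, x⟩ ⟨c, y'⟩ ⟨-, s, t, hb, ha, hx, hy, h⟩ ⟨-, s', t', hb', hc, hx', hy', h'⟩
      hyy
    obtain rfl : y = y' := hyy
    simp only at ha hb hb' hc hx hy h hx' hy' h'
    have hss : P.node s = P.node s' := hb.symm.trans hb'
    rw [ha, hc]
    congr 1
    rcases h with h | ⟨e, he, h⟩ <;> rcases h' with h' | ⟨e', he', h'⟩
    · rw [← h, ← h', hss]
    · refine absurd ?_ (hnot e' he' _ _ _ _ h')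
      rwa [← piece_eq_of_node_eq hss, piece_eq_of_node_eq h]
    · refine absurd ?_ (hnot e he _ _ _ _ h)
      rwa [piece_eq_of_node_eq hss, piece_eq_of_node_eq h']
    · exact hinj e he e' he' _ _ _ _ _ _ h h' hss
  have hin : ∀ t : ι × Γ, t.1 ∈ P.idx → ∀ x ∈ P.piece t, ∀ y ∈ P.piece t,
      S.Reachable (P.node t, x) (P.node t, y) := by
    intro t ht x hx y hy
    refine hL.good.setConn_piece hT hact hacyl ht (fun y => S.Reachable (P.node t, x) (P.node t, y))
      ?_ x hx y hy (SimpleGraph.Reachable.refl _)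
    intro a ha b hb hab h
    have hS : S.Adj (P.node t, a) (P.node t, b) := ⟨hab, t, t, rfl, rfl, ha, hb, Or.inl rfl⟩
    exact h.trans hS.reachable
  have hreach : ∀ s t : ι × Γ, s.1 ∈ P.idx → t.1 ∈ P.idx → ∀ x ∈ P.piece s, ∀ y ∈ P.piece t,
      S.Reachable (P.node s, x) (P.node t, y) := by
    intro s t hs ht x hx
    refine (hL.conn (fun t => ∀ y ∈ P.piece t, S.Reachable (P.node s, x) (P.node t, y))
      ?_ ?_ s t hs ht).mp (hin s hs x hx)
    · intro i g u hu
      have hn : P.node (i, g) = P.node (i, g * u) := by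
        rw [node_eq_iff]
        exact ⟨rfl, by simpa using hu⟩
      rw [hn, piece_eq_of_node_eq hn]
    · have key : ∀ e ∈ J, ∀ s' t' x' y', IsTranslate px py e s' t' x' y' → T.Adj x' y' →
          (∀ y ∈ P.piece s', S.Reachable (P.node s, x) (P.node s', y)) →
          ∀ y ∈ P.piece t', S.Reachable (P.node s, x) (P.node t', y) := by
        intro e he s' t' x' y' h hxy hs' y hy
        obtain ⟨ht', hy'⟩ := hidx e he _ _ _ _ h
        obtain ⟨-, hx'⟩ := hidx e he _ _ _ _ h.symm
        have hS : S.Adj (P.node s', x') (P.node t', y') :=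
          ⟨hxy, s', t', rfl, rfl, hx', hy', Or.inr ⟨e, he, h⟩⟩
        exact ((hs' x' hx').trans hS.reachable).trans (hin t' ht' y' hy' y hy)
      intro e he g
      have h := hact g _ _ (hadj e he)
      exact ⟨key e he _ _ _ _ (Or.inl ⟨g, rfl, rfl, rfl, rfl⟩) h,
        key e he _ _ _ _ (Or.inr ⟨g, rfl, rfl, rfl, rfl⟩) h.symm⟩
  rw [Finset.eq_empty_iff_forall_notMem]
  intro e he
  obtain ⟨g, hg1, hgx, hgy⟩ := hst _ _ (hadj e he)
  have hidx1 := (hL.isLinkSet e he).1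
  have hgx' : px e ∈ P.piece (translate g e.1) := by
    have := (smul_mem_piece_translate (g := g)).mpr (hpx e he)
    rwa [hgx] at this
  have heq := hT.isAcyclic.eq_of_reachable_of_locally_injective φ hloc
    (hreach (translate g e.1) e.1 hidx1 hidx1 (px e) hgx' (px e) (hpx e he)) rfl
  have hn : P.node (translate g e.1) = P.node (translate 1 e.1) := by
    simpa [translate] using congrArg Prod.fst heq
  exact hdisj e he _ (hsmul e.1 g 1 hn hg1 _ (by rw [hgy, one_smul])) (hpy e he)

end Pieces

theorem SimpleGraph.Connected.exists_finset_spanning {V : Type v} {T : SimpleGraph V}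
    (hT : T.Connected) (v₀ : V) (X : Finset V) :
    ∃ (I : Finset V) (E : Finset (V × V)), v₀ ∈ I ∧ X ⊆ I ∧ E.card + 1 ≤ I.card ∧
      (∀ e ∈ E, e.1 ∈ I ∧ e.2 ∈ I ∧ T.Adj e.1 e.2) ∧
      ∀ f : V → Prop, (∀ e ∈ E, (f e.1 ↔ f e.2)) → ∀ a ∈ I, (f v₀ ↔ f a) := by
  classical
  have key : ∀ (Q : Finset V → Prop), (∃ (I : Finset V) (E : Finset (V × V)), v₀ ∈ I ∧ Q I ∧
      E.card + 1 ≤ I.card ∧ (∀ e ∈ E, e.1 ∈ I ∧ e.2 ∈ I ∧ T.Adj e.1 e.2) ∧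
      ∀ f : V → Prop, (∀ e ∈ E, (f e.1 ↔ f e.2)) → ∀ a ∈ I, (f v₀ ↔ f a)) →
      (∀ I b, Q I → Q (insert b I)) → ∀ v, ∃ (I : Finset V) (E : Finset (V × V)), v₀ ∈ I ∧
      (v ∈ I ∧ Q I) ∧ E.card + 1 ≤ I.card ∧ (∀ e ∈ E, e.1 ∈ I ∧ e.2 ∈ I ∧ T.Adj e.1 e.2) ∧
      ∀ f : V → Prop, (∀ e ∈ E, (f e.1 ↔ f e.2)) → ∀ a ∈ I, (f v₀ ↔ f a) := by
    rintro Q ⟨I, E, h0, hQ, h⟩ hmono v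
    refine hT.forall_of_adj (fun v => ∃ (I : Finset V) (E : Finset (V × V)), v₀ ∈ I ∧
      (v ∈ I ∧ Q I) ∧ E.card + 1 ≤ I.card ∧ (∀ e ∈ E, e.1 ∈ I ∧ e.2 ∈ I ∧ T.Adj e.1 e.2) ∧
      ∀ f : V → Prop, (∀ e ∈ E, (f e.1 ↔ f e.2)) → ∀ a ∈ I, (f v₀ ↔ f a)) ?_
      (u := v₀) ⟨I, E, h0, ⟨h0, hQ⟩, h⟩ v
    rintro a b hab ⟨I, E, h0, ⟨ha, hQ⟩, hcard, hE, hf⟩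
    by_cases hb : b ∈ I
    · exact ⟨I, E, h0, ⟨hb, hQ⟩, hcard, hE, hf⟩
    refine ⟨insert b I, insert (a, b) E, Finset.mem_insert_of_mem h0,
      ⟨Finset.mem_insert_self _ _, hmono _ _ hQ⟩, ?_, ?_, ?_⟩
    · rw [Finset.card_insert_of_notMem hb]
      exact Nat.succ_le_succ ((Finset.card_insert_le _ _).trans hcard)
    · intro e he
      rcases Finset.mem_insert.mp he with rfl | he
      · exact ⟨Finset.mem_insert_of_mem ha, Finset.mem_insert_self _ _, hab⟩
      · obtain ⟨h1, h2, h3⟩ := hE e he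
        exact ⟨Finset.mem_insert_of_mem h1, Finset.mem_insert_of_mem h2, h3⟩
    · intro f hf' c hc
      have hf := hf f fun e he => hf' e (Finset.mem_insert_of_mem he)
      rcases Finset.mem_insert.mp hc with rfl | hc
      · exact (hf a ha).trans (hf' (a, c) (Finset.mem_insert_self _ _))
      · exact hf c hc
  induction X using Finset.induction_on with
  | empty => exact ⟨{v₀}, ∅, by simp, by simp, by simp, by simp, by simp⟩
  | insert x X _ ih =>
    simp only [Finset.insert_subset_iff]
    exact key (X ⊆ ·) ih (fun I b h => h.trans (Finset.subset_insert _ _)) x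

namespace Pieces

variable {V : Type v} {Γ : Type u} [Group Γ] [MulAction Γ V] {T : SimpleGraph V}

theorem exists_legal_of_closure_eq_top (hT : T.IsTree)
    (hact : ∀ (g : Γ) (u w : V), T.Adj u w → T.Adj (g • u) (g • w)) (k : ℕ)
    {x y : V} (hxy : T.Adj x y) {S : Finset Γ} (hS : Subgroup.closure (S : Set Γ) = ⊤) :
    ∃ (P : Pieces V Γ V) (J : _), P.Legal T k (2 * k * (S.card - 1)) J := by
  classical
  obtain ⟨I, E, hx, hX, hcard, hE, hf⟩ := hT.connected.exists_finset_spanning x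
    (S.image fun s => s • y)
  have hSI : ∀ s ∈ S, s • y ∈ I := fun s hs => hX (Finset.mem_image_of_mem _ hs)
  let P : Pieces V Γ V := ⟨I, fun _ => ⊥, fun v => {v}⟩
  have hpiece : ∀ v g, g • v ∈ P.piece (v, g) := by
    intro v g
    simp [P, piece, hull_bot]
  let J : Finset ((V × Γ) × (V × Γ)) :=
    E.image (fun e => ((e.1, 1), (e.2, 1))) ∪ S.image (fun s => ((s • y, 1), (x, s)))
  have hJ : J.card ≤ E.card + S.card :=
    (Finset.card_union_le _ _).trans (add_le_add Finset.card_image_le Finset.card_image_le)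
  refine ⟨P, J, ⟨⟨x, hx⟩, fun i _ => Finset.singleton_nonempty i, fun i _ => ?_,
    fun i _ _ => Finset.card_singleton i⟩, ?_, ?_, ?_⟩
  · rw [← hull_eq_core_of_eq_bot rfl, hull_bot]
    simpa [P] using SetConn.singleton i
  · intro e he
    rcases Finset.mem_union.mp he with he | he
    · obtain ⟨e, heE, rfl⟩ := Finset.mem_image.mp he
      obtain ⟨h1, h2, h3⟩ := hE e heE
      exact ⟨h1, h2, e.1, by simpa using hpiece e.1 1, e.2, by simpa using hpiece e.2 1, h3⟩
    · obtain ⟨s, hs, rfl⟩ := Finset.mem_image.mp he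
      exact ⟨hSI s hs, hx, s • y, by simpa using hpiece (s • y) 1, s • x, hpiece x s,
        hact _ _ _ hxy.symm⟩
  · intro f _ hf2
    have h1 : ∀ g, ∀ a ∈ I, (f (x, g) ↔ f (a, g)) := by
      intro g
      refine hf (fun a => f (a, g)) fun e he => ?_
      have := hf2 ((e.1, 1), (e.2, 1))
        (Finset.mem_union_left _ (Finset.mem_image_of_mem _ he)) g
      simpa [translate] using this
    have h2 : ∀ s ∈ S, ∀ g, (f (x, g) ↔ f (x, g * s)) := by
      intro s hs g
      have := hf2 ((s • y, 1), (x, s))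
        (Finset.mem_union_right _ (Finset.mem_image.mpr ⟨s, hs, rfl⟩)) g
      simp only [translate, mul_one] at this
      exact (h1 g _ (hSI s hs)).trans this
    have h3 : ∀ g : Γ, ∀ h, (f (x, h) ↔ f (x, h * g)) := by
      intro g
      have hg : g ∈ Subgroup.closure (S : Set Γ) := hS ▸ Subgroup.mem_top g
      induction hg using Subgroup.closure_induction with
      | mem s hs => exact h2 s hs
      | one => simp
      | mul a b _ _ iha ihb =>
        intro h
        rw [← mul_assoc]
        exact (iha h).trans (ihb _)
      | inv a _ iha =>
        intro h
        simpa using (iha (h * a⁻¹)).symm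
    rintro ⟨a, g⟩ ⟨b, h⟩ ha hb
    rw [← h1 g a ha, ← h1 h b hb]
    simpa using h3 (g⁻¹ * h) g
  · have hw : ∑ i ∈ P.idx, P.weight k i = -(2 * k * I.card : ℤ) := by
      simp [weight, P]
      ring
    rw [hw]
    have h4 : (J.card : ℤ) + 1 ≤ I.card + S.card := by
      have : J.card + 1 ≤ I.card + S.card := by omega
      exact_mod_cast this
    nlinarith [mul_le_mul_of_nonneg_left h4 (by positivity : (0 : ℤ) ≤ 2 * k)]

theorem Legal.card_quotient_le [Nontrivial Γ]
    (hmin : ∀ W : Set V, W.Nonempty → (∀ g : Γ, ∀ x ∈ W, g • x ∈ W) →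
      (T.induce W).Connected → W = Set.univ) {ι : Type*} {P : Pieces V Γ ι} {k : ℕ} {N : ℤ}
    (hL : P.Legal T k N ∅) :
    Finite (Quotient (MulAction.orbitRel Γ V)) ∧
      (Nat.card (Quotient (MulAction.orbitRel Γ V)) : ℤ) ≤ 1 + N := by
  classical
  obtain ⟨i, hi⟩ := hL.good.idx_nonempty
  have hconn := hL.conn (fun t => t.1 = i ∧ t.2 ∈ P.grp i) (by
    intro j g u hu
    refine and_congr_right fun h => ?_
    obtain rfl : j = i := h
    exact ((P.grp j).mul_mem_cancel_right hu).symm) (by simp) (i, 1)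
  have htop : P.grp i = ⊤ :=
    (Subgroup.eq_top_iff' _).mpr fun g => ((hconn (i, g) hi hi).mp ⟨rfl, one_mem _⟩).2
  have hidx : P.idx = {i} := Finset.eq_singleton_iff_unique_mem.mpr
    ⟨hi, fun j hj => ((hconn (j, 1) hi hj).mp ⟨rfl, one_mem _⟩).1⟩
  have hcore : core (P.grp i) (P.fin i) = Set.univ := by
    have hne : (core (P.grp i) (P.fin i)).Nonempty :=
      (Finset.coe_nonempty.mpr (hL.good.fin_nonempty i hi)).mono (subset_core _ _)
    exact hmin _ hne (fun g x hx => smul_mem_core (by simp [htop]) hx)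
      ((hL.good.setConn i hi).induce_connected hne)
  have hsurj : Function.Surjective fun c : P.fin i =>
      (Quotient.mk _ c.1 : Quotient (MulAction.orbitRel Γ V)) := by
    intro q
    induction q using Quotient.inductionOn with | h v => ?_
    obtain ⟨g, -, c, hc, rfl⟩ : v ∈ core (P.grp i) (P.fin i) := hcore ▸ Set.mem_univ v
    refine ⟨⟨c, hc⟩, Quotient.sound ?_⟩
    exact MulAction.orbitRel_apply.mpr ⟨g⁻¹, by simp⟩
  have hle := Nat.card_le_card_of_surjective _ hsurj
  rw [Nat.card_eq_fintype_card (α := P.fin i), Fintype.card_coe] at hle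
  refine ⟨Finite.of_surjective _ hsurj, ?_⟩
  have hw := hL.weight_le
  rw [hidx, Finset.sum_singleton, weight, if_neg (by rw [htop]; exact top_ne_bot),
    Finset.card_empty] at hw
  push_cast at hw
  have : (Nat.card (Quotient (MulAction.orbitRel Γ V)) : ℤ) ≤ (P.fin i).card := by
    exact_mod_cast hle
  linarith

end Pieces

/-- Weidmann's acylindrical accessibility theorem: if `Γ` is a finitely generated,
non-cyclic, freely indecomposable group acting on a tree `T` by automorphisms, minimally
and `k`-acylindrically, then the number of `Γ`-orbits of vertices of `T` is at most
`1 + 2k(rk Γ − 1)`. -/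
theorem stmt_5 {V : Type v} {Γ : Type u} [Group Γ] [Group.FG Γ] [MulAction Γ V]
    (hnc : ¬ IsCyclic Γ)
    (hfi : ∀ (A B : Type u) [Group A] [Group B], Nontrivial A → Nontrivial B →
      IsEmpty (Γ ≃* Monoid.Coprod A B))
    (T : SimpleGraph V) (hT : T.IsTree)
    (hact : ∀ (g : Γ) (u w : V), T.Adj u w → T.Adj (g • u) (g • w))
    (hmin : ∀ W : Set V, W.Nonempty → (∀ g : Γ, ∀ x ∈ W, g • x ∈ W) →
      (T.induce W).Connected → W = Set.univ)
    (k : ℕ)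
    (hacyl : ∀ g : Γ, g ≠ 1 → ∀ m : ℕ, k < m → ∀ p : ℕ → V,
      (∀ i < m, T.Adj (p i) (p (i + 1))) →
      (∀ i, 1 ≤ i → i < m → s(p i, p (i + 1)) ≠ s(p (i - 1), p i)) →
      ¬ (∀ i ≤ m, g • p i = p i)) :
    Finite (Quotient (MulAction.orbitRel Γ V)) ∧
      Nat.card (Quotient (MulAction.orbitRel Γ V)) ≤ 1 + 2 * k * (Group.rank Γ - 1) := by
  classical
  have hnt : Nontrivial Γ := by
    by_contra h
    rw [not_nontrivial_iff_subsingleton] at h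
    exact hnc inferInstance
  obtain ⟨x⟩ := hT.connected.nonempty
  by_cases hE : ∃ x y, T.Adj x y
  swap
  · push Not at hE
    have hV : ∀ y, y = x := fun y =>
      hT.connected.forall_of_adj (· = x) (fun u w h => absurd h (hE u w)) rfl y
    have : Subsingleton V := ⟨fun a b => (hV a).trans (hV b).symm⟩
    have : Subsingleton (Quotient (MulAction.orbitRel Γ V)) := Quot.Subsingleton
    exact ⟨inferInstance, Finite.card_le_one_iff_subsingleton.mpr this |>.trans (by simp)⟩
  clear x
  obtain ⟨x, y, hxy⟩ := hE
  have hst : ∀ x y, T.Adj x y → ∃ g : Γ, g ≠ 1 ∧ g • x = x ∧ g • y = y := fun x y hxy =>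
    exists_ne_one_smul_eq_of_adj hnc hfi hT hact hmin hxy
  have hk : 1 ≤ k := by
    by_contra hk
    obtain ⟨g, hg1, hgx, hgy⟩ := hst x y hxy
    refine hacyl g hg1 1 (by omega) (fun i => if i = 0 then x else y) ?_ ?_ ?_
    · intro i hi
      obtain rfl : i = 0 := by omega
      simpa using hxy
    · intro i h1 h2
      omega
    · intro i _
      by_cases hi : i = 0 <;> simp [hi, hgx, hgy]
  obtain ⟨S, hS, hS'⟩ := Group.rank_spec Γ
  have hex : ∃ n, ∃ (P : Pieces V Γ V) (J : _), P.Legal T k (2 * k * (S.card - 1)) J ∧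
      J.card = n := by
    obtain ⟨P, J, h⟩ := Pieces.exists_legal_of_closure_eq_top hT hact k hxy hS'
    exact ⟨_, P, J, h, rfl⟩
  obtain ⟨P, J, hL, hJ⟩ := Nat.find_spec hex
  have hJ0 := hL.eq_empty_of_forall_card_le hT hact hk hacyl hst fun P' J' hL' =>
    hJ.le.trans (Nat.find_min' hex ⟨P', J', hL', rfl⟩)
  subst hJ0
  obtain ⟨hfin, hcard⟩ := hL.card_quotient_le hmin
  refine ⟨hfin, ?_⟩
  have hr : 1 ≤ Group.rank Γ := by
    rw [← hS, Nat.one_le_iff_ne_zero, Ne, Finset.card_eq_zero]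
    rintro rfl
    simp at hS'
  rw [hS] at hcard
  zify [hr]
  exact hcard
end

section
/- Let Γ be a group, let F be a free group of finite rank r with r ≥ 2, let q : Γ → F and ψ : F → ℤ be surjective group homomorphisms, and set φ = ψ ∘ q. Then for every integer n ≥ 1, the subgroup Γ_n = φ⁻¹(nℤ) of Γ cannot be generated by fewer than n(r−1)+1 elements; that is, rk Γ_n ≥ n(r−1)+1. -/
/-- A `1`-cocycle of `G` with values in the functions `A → K`, on which `G` acts by translation
through `χ : G →* Multiplicative A`. -/
def IsTranslationCocycle {G A K : Type*} [Group G] [AddCommGroup A] [AddCommGroup K]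
    (χ : G →* Multiplicative A) (c : G → A → K) : Prop :=
  ∀ g h i, c (g * h) i = c h i + c g (i + (χ h).toAdd)

namespace IsTranslationCocycle

section Basic

variable {G A K : Type*} [Group G] [AddCommGroup A] [AddCommGroup K]
  {χ : G →* Multiplicative A} {c d : G → A → K}

theorem sub (hc : IsTranslationCocycle χ c) (hd : IsTranslationCocycle χ d) :
    IsTranslationCocycle χ (c - d) := by
  intro g h i
  simp only [Pi.sub_apply, hc g h i, hd g h i]
  abel

theorem comp {H : Type*} [Group H] (hc : IsTranslationCocycle χ c) (q : H →* G) :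
    IsTranslationCocycle (χ.comp q) (fun g => c (q g)) := by
  intro g h i
  simp only [map_mul, hc (q g) (q h) i, MonoidHom.comp_apply]

theorem map_one (hc : IsTranslationCocycle χ c) (i : A) : c 1 i = 0 := by
  have h := hc 1 1 i
  simpa using h

theorem eq_zero_of_mem_ker (hc : IsTranslationCocycle χ c) {S : Set G}
    (hS : Subgroup.closure S = χ.ker) (h0 : ∀ s ∈ S, c s 0 = 0) {g : G} (hg : g ∈ χ.ker) :
    c g 0 = 0 := by
  have hker : ∀ x ∈ Subgroup.closure S, χ x = 1 := fun x hx => by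
    rw [hS] at hx
    exact hx
  rw [← hS] at hg
  induction hg using Subgroup.closure_induction with
  | mem x hx => exact h0 x hx
  | one => exact hc.map_one 0
  | mul x y hx hy ihx ihy => simp [hc x y 0, ihx, ihy, hker y hy]
  | inv x hx ih =>
    have h := hc x⁻¹ x 0
    simpa [hc.map_one, ih, hker x hx] using h.symm

end Basic

/-- Every function on the generators of a free group extends to a cocycle. -/
theorem exists_freeGroup_extension {ι A K : Type*} [AddCommGroup A] [AddCommGroup K]
    (χ : FreeGroup ι →* Multiplicative A) (f : ι → A → K) :
    ∃ c : FreeGroup ι → A → K, IsTranslationCocycle χ c ∧ ∀ x, c (FreeGroup.of x) = f x := by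
  let D : FreeGroup ι →* Equiv.Perm (A × K) := FreeGroup.lift fun x =>
    { toFun := fun p => (p.1 + (χ (FreeGroup.of x)).toAdd, p.2 + f x p.1)
      invFun := fun p => (p.1 - (χ (FreeGroup.of x)).toAdd,
        p.2 - f x (p.1 - (χ (FreeGroup.of x)).toAdd))
      left_inv := fun p => by simp
      right_inv := fun p => by simp }
  have hof (x : ι) (p : A × K) :
      D (FreeGroup.of x) p = (p.1 + (χ (FreeGroup.of x)).toAdd, p.2 + f x p.1) := by
    simp [D]
  have hD (g : FreeGroup ι) : ∃ u : A → K, ∀ p, D g p = (p.1 + (χ g).toAdd, p.2 + u p.1) := by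
    induction g using FreeGroup.induction_on with
    | C1 => exact ⟨0, fun p => by simp⟩
    | of x => exact ⟨f x, hof x⟩
    | inv_of x _ =>
      refine ⟨fun i => -f x (i - (χ (FreeGroup.of x)).toAdd), fun p => ?_⟩
      rw [map_inv, Equiv.Perm.inv_eq_iff_eq, hof]
      simp [← sub_eq_add_neg]
    | mul g h hg hh =>
      obtain ⟨u, hu⟩ := hg
      obtain ⟨v, hv⟩ := hh
      refine ⟨fun i => v i + u (i + (χ h).toAdd), fun p => ?_⟩
      rw [map_mul, Equiv.Perm.mul_apply, hv, hu]
      ext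
      · simp only [map_mul, toAdd_mul]
        abel
      · simp only [add_assoc]
  choose c hc using hD
  refine ⟨c, fun g h i => ?_, fun x => funext fun i => ?_⟩
  · have key := hc (g * h) (i, 0)
    rw [map_mul, Equiv.Perm.mul_apply, hc, hc] at key
    simpa using (congrArg Prod.snd key).symm
  · have key := hc (FreeGroup.of x) (i, 0)
    rw [hof] at key
    simpa using (congrArg Prod.snd key).symm

section ZMod

variable {G K : Type*} [Group G] [AddCommGroup K] {n : ℕ} [NeZero n]
  {χ : G →* Multiplicative (ZMod n)} {c : G → ZMod n → K}

/-- A cocycle vanishes as soon as it vanishes at `0` on generators of the kernel of `χ` and away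
from `0` on an element that `χ` sends to `1`. -/
theorem eq_zero (hc : IsTranslationCocycle χ c) {S : Set G}
    (hS : Subgroup.closure S = χ.ker) (h0 : ∀ s ∈ S, c s 0 = 0) {t : G}
    (ht : χ t = Multiplicative.ofAdd 1) (h1 : ∀ i, i ≠ 0 → c t i = 0) : c = 0 := by
  have hχ (k : ℕ) : (χ (t ^ k)).toAdd = (k : ZMod n) := by simp [ht]
  have hker {g : G} (hg : (χ g).toAdd = 0) : c g 0 = 0 :=
    hc.eq_zero_of_mem_ker hS h0 (MonoidHom.mem_ker.2 hg)
  have hpow (k : ℕ) (hk : k < n) : c (t ^ k) 1 = 0 := by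
    induction k with
    | zero => simp [hc.map_one]
    | succ k ih =>
      rw [pow_succ', hc, ih (by omega), hχ, h1, add_zero]
      have : ((k + 1 : ℕ) : ZMod n) ≠ 0 := fun h =>
        absurd (Nat.le_of_dvd k.succ_pos ((ZMod.natCast_eq_zero_iff _ _).1 h)) (by omega)
      rwa [Nat.cast_succ, add_comm] at this
  have ht0 : c t 0 = 0 := by
    have hn : n - 1 + 1 = n := Nat.sub_add_cancel NeZero.one_le
    have key := hc (t ^ (n - 1)) t 0
    rw [← pow_succ, hn, hker (by simp), ht, toAdd_ofAdd, zero_add,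
      hpow _ (by omega), add_zero] at key
    exact key.symm
  have hct (i : ZMod n) : c t i = 0 := by
    by_cases hi : i = 0
    · rw [hi, ht0]
    · exact h1 i hi
  have hctp (k : ℕ) (i : ZMod n) : c (t ^ k) i = 0 := by
    induction k with
    | zero => simp [hc.map_one]
    | succ k ih => rw [pow_succ', hc, ih, hct, add_zero]
  funext g i
  set m := (i + (χ g).toAdd).val
  have hmem : (χ ((t ^ m)⁻¹ * (g * t ^ i.val))).toAdd = 0 := by
    rw [χ.map_mul, χ.map_mul, toAdd_mul, toAdd_mul, χ.map_inv, toAdd_inv, hχ, hχ]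
    simp only [m, ZMod.natCast_zmod_val]
    abel
  have key := hc (t ^ m) ((t ^ m)⁻¹ * (g * t ^ i.val)) 0
  rw [mul_inv_cancel_left, hctp, add_zero, hker hmem, hc, hctp, hχ, zero_add, zero_add,
    ZMod.natCast_zmod_val] at key
  exact key

end ZMod

end IsTranslationCocycle

/-- A lower bound, of Nielsen–Schreier type, for the number of generators of the kernel of a
surjection onto a finite cyclic group that factors through a free group. -/
theorem FreeGroup.mul_le_card_add_of_closure_eq_ker {G ι : Type*} [Group G] [Fintype ι] {n : ℕ}
    [NeZero n] (q : G →* FreeGroup ι) (hq : Function.Surjective q)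
    (χ : FreeGroup ι →* Multiplicative (ZMod n)) (hχ : Function.Surjective χ) (S : Finset G)
    (hS : Subgroup.closure (S : Set G) = (χ.comp q).ker) :
    Fintype.card ι * n ≤ S.card + (n - 1) := by
  classical
  obtain ⟨t, ht⟩ := (hχ.comp hq) (Multiplicative.ofAdd 1)
  choose c hc hcof using
    IsTranslationCocycle.exists_freeGroup_extension (K := ZMod 2) χ
  let Φ (f : ι → ZMod n → ZMod 2) : (S → ZMod 2) × ({i : ZMod n // i ≠ 0} → ZMod 2) :=
    (fun s => c f (q s) 0, fun i => c f (q t) i)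
  have hΦ : Function.Injective Φ := by
    intro f f' h
    have h0 := IsTranslationCocycle.eq_zero (((hc f).sub (hc f')).comp q) hS
      (fun s hs => sub_eq_zero.2 (congrFun (congrArg Prod.fst h) ⟨s, hs⟩)) ht
      (fun i hi => sub_eq_zero.2 (congrFun (congrArg Prod.snd h) ⟨i, hi⟩))
    funext x
    obtain ⟨g, hg⟩ := hq (FreeGroup.of x)
    have hx := congrFun h0 g
    simp only [hg, Pi.sub_apply, hcof] at hx
    exact sub_eq_zero.1 hx
  have hcard := Fintype.card_le_of_injective Φ hΦ
  simp only [Fintype.card_prod, Fintype.card_fun, ZMod.card, Fintype.card_coe,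
    Fintype.card_subtype_compl, Fintype.card_subtype_eq, ne_eq, ← pow_mul, ← pow_add] at hcard
  rw [mul_comm]
  exact (Nat.pow_le_pow_iff_right one_lt_two).1 hcard

/-- If `q : Γ → F` is a surjection onto a free group `F` of rank `r ≥ 2`,
`ψ : F → ℤ` is a surjective homomorphism (with `ℤ` written multiplicatively), and
`φ = ψ ∘ q`, then for every `n ≥ 1` the subgroup `Γ_n = φ⁻¹(nℤ)` cannot be generated by
fewer than `n(r−1)+1` elements: every (finite) generating set has at least `n(r−1)+1`
elements. -/
theorem stmt_7 {Γ : Type*} [Group Γ] (r : ℕ) (hr : 2 ≤ r)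
    (q : Γ →* FreeGroup (Fin r)) (hq : Function.Surjective q)
    (ψ : FreeGroup (Fin r) →* Multiplicative ℤ) (hψ : Function.Surjective ψ)
    (n : ℕ) (hn : 1 ≤ n) :
    ∀ S : Finset Γ,
      Subgroup.closure (S : Set Γ) =
        Subgroup.comap (ψ.comp q)
          (AddSubgroup.toSubgroup (AddSubgroup.zmultiples (n : ℤ))) →
      n * (r - 1) + 1 ≤ S.card := by
  intro S hS
  have : NeZero n := ⟨by omega⟩
  let red : Multiplicative ℤ →* Multiplicative (ZMod n) :=
    AddMonoidHom.toMultiplicative (Int.castAddHom (ZMod n))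
  have hred : Function.Surjective red := fun x => by
    obtain ⟨k, hk⟩ := ZMod.intCast_surjective x.toAdd
    exact ⟨Multiplicative.ofAdd k, congrArg Multiplicative.ofAdd hk⟩
  have hker : red.ker = AddSubgroup.toSubgroup (AddSubgroup.zmultiples (n : ℤ)) := by
    ext x
    change ((x.toAdd : ℤ) : ZMod n) = 0 ↔ x.toAdd ∈ AddSubgroup.zmultiples (n : ℤ)
    rw [Int.mem_zmultiples_iff, ZMod.intCast_zmod_eq_zero_iff_dvd]
  have h := FreeGroup.mul_le_card_add_of_closure_eq_ker q hq (red.comp ψ) (hred.comp hψ) S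
    (by rw [hS, ← hker, MonoidHom.comap_ker, MonoidHom.comp_assoc])
  rw [Fintype.card_fin] at h
  obtain ⟨r, rfl⟩ := Nat.exists_eq_add_of_le' (by omega : 1 ≤ r)
  rw [add_mul, one_mul, mul_comm] at h
  rw [Nat.add_sub_cancel]
  omega
end

section
/- Let Π be a group acting on a tree T by automorphisms, preserving a Π-invariant orientation O of T (in particular the action is without inversions). Let e₀ be an edge oriented from v₀ to v₁, let e' be an edge containing v₀ and oriented toward v₀, and let τ ∈ Π satisfy τ·e' = e₀. Set Γ = Stab(v₀), Λ = Stab(e₀) and Λ₊ = Stab(e'). Let ε₀ = 1, and let ε₁,…,ε_k ∈ {1,−1} and γ₁,…,γ_k ∈ Γ be such that γ_i ∉ Λ₊ whenever (ε_{i−1}, ε_i) = (1,−1), and γ_i ∉ Λ whenever (ε_{i−1}, ε_i) = (−1,1). For 1 ≤ j ≤ k define δ_j = τ(γ₁τ^{ε₁})(γ₂τ^{ε₂})⋯(γ_{j−1}τ^{ε_{j−1}}) (so δ₁ = τ), and set e_j = δ_jγ_j·e₀ if ε_j = 1 and e_j = δ_jγ_j·e' if ε_j = −1. Then e₀, e₁,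 …, e_k is a segment of length k+1 in T: for each j ≥ 1 the edges e_j and e_{j−1} are distinct and share an endpoint. Consequently, if some g ∈ Π ∖ {1} stabilizes e_j for every 0 ≤ j ≤ k, then g fixes pointwise every vertex of a segment of length k+1, so the action of Π on T is k-cylindrical (i.e., not k-acylindrical). -/
/-- A segment of length `m` in a graph: `m` edges `f 0, …, f (m-1)` such that consecutive
edges are distinct and share an endpoint. -/
def IsSegment {V : Type*} (T : SimpleGraph V) (m : ℕ) (f : ℕ → Sym2 V) : Prop :=
  (∀ i < m, f i ∈ T.edgeSet) ∧
  ∀ i, 1 ≤ i → i < m → f i ≠ f (i - 1) ∧ ∃ x, x ∈ f i ∧ x ∈ f (i - 1)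

/-- The action of `Gp` on (the tree) `T` is `k`-acylindrical if no `g ≠ 1` fixes pointwise
every vertex of a segment of length greater than `k`. -/
def Acylindrical (Gp : Type*) {V : Type*} [Group Gp] [MulAction Gp V]
    (T : SimpleGraph V) (k : ℕ) : Prop :=
  ∀ h : Gp, h ≠ 1 → ∀ m, k < m → ∀ f : ℕ → Sym2 V, IsSegment T m f →
    ¬ (∀ i < m, ∀ x ∈ f i, h • x = x)

/-- The edges `e_0 = e₀` and, for `j ≥ 1`, `e_j = δ_jγ_j • e₀` if `ε j = 1` and
`e_j = δ_jγ_j • e'` if `ε j = −1`. -/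
def eseqN {V : Type*} {Gp : Type*} [Group Gp] [MulAction Gp V]
    (τ : Gp) (γ : ℕ → Gp) (ε : ℕ → ℤ) (e₀ e' : Sym2 V) (j : ℕ) : Sym2 V :=
  if j = 0 then e₀
  else if ε j = 1 then Sym2.map ((dseqN τ γ ε j * γ j) • ·) e₀
  else Sym2.map ((dseqN τ γ ε j * γ j) • ·) e'

theorem Sym2.map_mul_smul {V Gp : Type*} [Group Gp] [MulAction Gp V] (g h : Gp) (e : Sym2 V) :
    Sym2.map ((g * h) • ·) e = Sym2.map (g • ·) (Sym2.map (h • ·) e) := by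
  rw [Sym2.map_map]
  congr 1
  funext x
  exact mul_smul g h x

theorem Sym2.map_inv_smul {V Gp : Type*} [Group Gp] [MulAction Gp V] {g : Gp} {e f : Sym2 V}
    (h : Sym2.map (g • ·) e = f) : Sym2.map (g⁻¹ • ·) f = e := by
  rw [← h, ← Sym2.map_mul_smul]
  simp

theorem Sym2.map_smul_mem_edgeSet {V Gp : Type*} [Group Gp] [MulAction Gp V] {T : SimpleGraph V}
    (hact : ∀ (g : Gp) (u w : V), T.Adj u w → T.Adj (g • u) (g • w)) (g : Gp) {e : Sym2 V}
    (he : e ∈ T.edgeSet) : Sym2.map (g • ·) e ∈ T.edgeSet := by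
  induction e using Sym2.ind with
  | _ u w => exact hact g u w he

/-- An element stabilizing an edge fixes both endpoints when there is an invariant orientation. -/
theorem smul_eq_of_map_smul_eq {V Gp : Type*} [Group Gp] [MulAction Gp V] {T : SimpleGraph V}
    {O : Sym2 V → V × V} (hO : ∀ e ∈ T.edgeSet, s((O e).1, (O e).2) = e)
    (hOinv : ∀ (g : Gp), ∀ e ∈ T.edgeSet,
      O (Sym2.map (g • ·) e) = (g • (O e).1, g • (O e).2))
    {g : Gp} {e : Sym2 V} (he : e ∈ T.edgeSet) (hg : Sym2.map (g • ·) e = e)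
    {x : V} (hx : x ∈ e) : g • x = x := by
  have h := hOinv g e he
  rw [hg] at h
  rw [← hO e he, Sym2.mem_iff] at hx
  rcases hx with rfl | rfl
  · exact (congrArg Prod.fst h).symm
  · exact (congrArg Prod.snd h).symm

theorem dseqN_succ {Gp : Type*} [Group Gp] (τ : Gp) (γ : ℕ → Gp) (ε : ℕ → ℤ) {j : ℕ}
    (hj : 1 ≤ j) : dseqN τ γ ε (j + 1) = dseqN τ γ ε j * γ j * τ ^ ε j := by
  obtain ⟨n, rfl⟩ := Nat.exists_eq_add_of_le' hj
  simp [dseqN, List.range_succ, mul_assoc]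

theorem eseqN_succ {V Gp : Type*} [Group Gp] [MulAction Gp V]
    (τ : Gp) (γ : ℕ → Gp) (ε : ℕ → ℤ) (e₀ e' : Sym2 V) (j : ℕ) :
    eseqN τ γ ε e₀ e' (j + 1) = Sym2.map (dseqN τ γ ε (j + 1) • ·)
      (Sym2.map (γ (j + 1) • ·) (if ε (j + 1) = 1 then e₀ else e')) := by
  rw [← Sym2.map_mul_smul]
  simp only [eseqN, Nat.succ_ne_zero, if_false]
  split_ifs <;> rfl

/-- Each edge of the sequence is the translate by `δ_{j+1}` of an edge at the base vertex. -/
theorem eseqN_eq_map_dseqN_succ {V Gp : Type*} [Group Gp] [MulAction Gp V]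
    {τ : Gp} (γ : ℕ → Gp) {ε : ℕ → ℤ} {e₀ e' : Sym2 V} (hτ : Sym2.map (τ • ·) e' = e₀)
    (hε0 : ε 0 = 1) {j : ℕ} (hj : 1 ≤ j → ε j = 1 ∨ ε j = -1) :
    eseqN τ γ ε e₀ e' j =
      Sym2.map (dseqN τ γ ε (j + 1) • ·) (if ε j = 1 then e' else e₀) := by
  cases j with
  | zero => simp [eseqN, dseqN, hε0, hτ]
  | succ n =>
    rw [eseqN_succ, dseqN_succ τ γ ε n.succ_pos, Sym2.map_mul_smul, Sym2.map_mul_smul]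
    congr 2
    rcases hj n.succ_pos with h | h
    · simp [h, hτ]
    · simpa [h] using (Sym2.map_inv_smul hτ).symm

/-- Converse direction, non-separating case: if `Gp` acts on a tree `T` by automorphisms
preserving an invariant orientation `O`, `e₀ = {v₀, v₁}` is an edge oriented from `v₀` to
`v₁`, `e'` is an edge at `v₀` oriented toward `v₀`, `τ • e' = e₀`, and `γ₁,…,γ_k ∈ Stab(v₀)`
and signs `ε` satisfy `γ i ∉ Stab(e')` when `(ε (i-1), ε i) = (1,−1)` and `γ i ∉ Stab(e₀)`
when `(ε (i-1), ε i) = (−1,1)`, then the edges `e_j` (with `e_j = δ_jγ_j • e₀` or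
`δ_jγ_j • e'` according to the sign `ε j`) form a segment of length `k+1`; and any `g ≠ 1`
stabilizing every `e_j` fixes pointwise every vertex of this segment, so the action is
`k`-cylindrical. -/
theorem stmt_9 {V : Type*} {Gp : Type*} [Group Gp] [MulAction Gp V]
    (T : SimpleGraph V) (hT : T.IsTree)
    (hact : ∀ (g : Gp) (u w : V), T.Adj u w → T.Adj (g • u) (g • w))
    (O : Sym2 V → V × V)
    (hO : ∀ e ∈ T.edgeSet, s((O e).1, (O e).2) = e)
    (hOinv : ∀ (g : Gp), ∀ e ∈ T.edgeSet,
      O (Sym2.map (g • ·) e) = (g • (O e).1, g • (O e).2))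
    (v₀ v₁ : V) (hadj : T.Adj v₀ v₁) (hOe0 : O s(v₀, v₁) = (v₀, v₁))
    (e' : Sym2 V) (he' : e' ∈ T.edgeSet) (hv0e' : v₀ ∈ e') (hOe' : (O e').2 = v₀)
    (τ : Gp) (hτ : Sym2.map (τ • ·) e' = s(v₀, v₁))
    (k : ℕ) (ε : ℕ → ℤ) (hε0 : ε 0 = 1)
    (hεval : ∀ i, 1 ≤ i → i ≤ k → ε i = 1 ∨ ε i = -1)
    (γ : ℕ → Gp)
    (hγ : ∀ i, 1 ≤ i → i ≤ k → γ i • v₀ = v₀)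
    (hγ' : ∀ i, 1 ≤ i → i ≤ k →
      (ε (i - 1) = 1 → ε i = -1 → Sym2.map (γ i • ·) e' ≠ e') ∧
      (ε (i - 1) = -1 → ε i = 1 → Sym2.map (γ i • ·) s(v₀, v₁) ≠ s(v₀, v₁))) :
    IsSegment T (k + 1) (eseqN τ γ ε s(v₀, v₁) e') ∧
    ∀ g : Gp, g ≠ 1 →
      (∀ j ≤ k, Sym2.map (g • ·) (eseqN τ γ ε s(v₀, v₁) e' j) = eseqN τ γ ε s(v₀, v₁) e' j) →
      (∀ j ≤ k, ∀ x ∈ eseqN τ γ ε s(v₀, v₁) e' j, g • x = x) ∧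
      ¬ Acylindrical Gp T k := by
  have he₀ : s(v₀, v₁) ∈ T.edgeSet := hadj
  have hne : v₁ ≠ v₀ := hadj.ne'
  have hedge : ∀ j, eseqN τ γ ε s(v₀, v₁) e' j ∈ T.edgeSet := by
    intro j
    cases j with
    | zero => simpa [eseqN] using hadj
    | succ n =>
      rw [eseqN_succ]
      refine Sym2.map_smul_mem_edgeSet hact _ (Sym2.map_smul_mem_edgeSet hact _ ?_)
      split_ifs
      exacts [he₀, he']
  have hseg : IsSegment T (k + 1) (eseqN τ γ ε s(v₀, v₁) e') := by
    refine ⟨fun i _ => hedge i, fun i hi hik => ?_⟩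
    obtain ⟨n, rfl⟩ := Nat.exists_eq_add_of_le' hi
    have hn : n + 1 ≤ k := by omega
    have hfix := hγ (n + 1) hi hn
    have hεn : ε n = 1 ∨ ε n = -1 := by
      rcases Nat.eq_zero_or_pos n with rfl | h
      · exact .inl hε0
      · exact hεval n h (by omega)
    rw [Nat.add_sub_cancel, eseqN_succ, eseqN_eq_map_dseqN_succ γ hτ hε0 fun _ => hεn]
    constructor
    · refine (Sym2.map.injective (MulAction.injective _)).ne ?_
      obtain ⟨h₁, h₂⟩ := hγ' (n + 1) hi hn
      rw [Nat.add_sub_cancel] at h₁ h₂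
      rcases hεval (n + 1) hi hn with h | h <;> rcases hεn with h' | h' <;>
        simp only [h, h', if_true, reduceCtorEq, Int.reduceNeg, if_false]
      · intro heq
        have h₃ := hOinv (γ (n + 1)) _ he₀
        rw [heq, hOe0] at h₃
        have h₄ : γ (n + 1) • v₁ = v₀ := by rw [← hOe', h₃]
        exact hne (smul_left_cancel _ (h₄.trans hfix.symm))
      · exact h₂ h' h
      · exact h₁ h' h
      · intro heq
        have h₃ := hOinv (γ (n + 1)) _ he'
        rw [heq, hOe0, hOe', hfix] at h₃
        exact hne (congrArg Prod.snd h₃)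
    · refine ⟨dseqN τ γ ε (n + 1) • v₀, Sym2.mem_map.2 ⟨v₀, Sym2.mem_map.2 ⟨v₀, ?_, hfix⟩, rfl⟩,
        Sym2.mem_map.2 ⟨v₀, ?_, rfl⟩⟩ <;> split_ifs <;> simp [hv0e']
  refine ⟨hseg, fun g hg hstab => ?_⟩
  have hpt : ∀ j ≤ k, ∀ x ∈ eseqN τ γ ε s(v₀, v₁) e' j, g • x = x := fun j hj x hx =>
    smul_eq_of_map_smul_eq hO hOinv (hedge j) (hstab j hj) hx
  exact ⟨hpt, fun hac => hac g hg (k + 1) k.lt_succ_self _ hseg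
    fun i hi => hpt i (Nat.lt_succ_iff.1 hi)⟩
end
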